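/- arXiv:2410.18614 — 3 statements merged into one kernel-verified Lean document; each statement's English description precedes it below -/
import Mathlib

section
/- Let d ≥ 1, α ∈ (0,2), κ₁ ≥ 1, and let κ : ℝ^d → ℝ be measurable with 1 ≤ κ(y) ≤ κ₁ for all y and κ(−y) = κ(y). Then q is infinitely differentiable, and for every j ∈ ℕ and every β ≥ 0 there exists a constant C = C(j,β,d,α) > 0 (independent of κ and κ₁) such that for all z ∈ ℝ^{2d}, the j-th derivative satisfies ‖D^j q(z)‖ ≤ C · κ₁^β · (1+|z|)^{−β}. -/
open MeasureTheory Real RealInnerProductSpace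

/-- `ψ(ζ) = ∫_{|y|≤1} (1 − cos⟨ζ,y⟩) κ(y) |y|^{−d−α} dy`. -/
noncomputable def psiK (d : ℕ) (α : ℝ) (κ : EuclideanSpace ℝ (Fin d) → ℝ)
    (ζ : EuclideanSpace ℝ (Fin d)) : ℝ :=
  ∫ y in {y : EuclideanSpace ℝ (Fin d) | ‖y‖ ≤ 1},
    (1 - Real.cos ⟪ζ, y⟫) * κ y * ‖y‖ ^ (-(d : ℝ) - α)

/-- `φ(ξ,η) = ∫_0^1 ψ(sξ + η) ds`. -/
noncomputable def phiK (d : ℕ) (α : ℝ) (κ : EuclideanSpace ℝ (Fin d) → ℝ)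
    (w : EuclideanSpace ℝ (Fin d) × EuclideanSpace ℝ (Fin d)) : ℝ :=
  ∫ s in (0 : ℝ)..1, psiK d α κ (s • w.1 + w.2)

/-- The density `q` of the small-jump part `Z₁^{(0)}` of the kinetic process. -/
noncomputable def qK (d : ℕ) (α : ℝ) (κ : EuclideanSpace ℝ (Fin d) → ℝ)
    (z : EuclideanSpace ℝ (Fin d) × EuclideanSpace ℝ (Fin d)) : ℝ :=
  (2 * π) ^ (-(2 * (d : ℝ))) *
    ∫ w : EuclideanSpace ℝ (Fin d) × EuclideanSpace ℝ (Fin d),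
      Real.cos (⟪w.1, z.1⟫ + ⟪w.2, z.2⟫) * Real.exp (-(phiK d α κ w))

open scoped ContDiff

/-- Differentiation under the integral sign, with derivatives valued in a space isometric to the
space of continuous linear maps. -/
theorem hasFDerivAt_integral_of_isometryEquiv {P V E E' : Type*} [MeasurableSpace P]
    {μ : Measure P} [NormedAddCommGroup V] [NormedSpace ℝ V] [NormedAddCommGroup E]
    [NormedSpace ℝ E] [NormedAddCommGroup E'] [NormedSpace ℝ E'] (T : E' ≃ₗᵢ[ℝ] (V →L[ℝ] E))
    {g : P → V → E} {g' : P → V → E'} (hg : ∀ p x, HasFDerivAt (g p) (T (g' p x)) x)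
    (hgm : ∀ x, Integrable (fun p => g p x) μ) (w : V)
    (hg'm : AEStronglyMeasurable (fun p => g' p w) μ) {bound : P → ℝ} (hb : Integrable bound μ)
    (hbd : ∀ᵐ p ∂μ, ∀ x ∈ Metric.ball w 1, ‖g' p x‖ ≤ bound p) :
    HasFDerivAt (fun x => ∫ p, g p x ∂μ) (T (∫ p, g' p w ∂μ)) w := by
  have h : ∫ p, T (g' p w) ∂μ = T (∫ p, g' p w ∂μ) :=
    T.toContinuousLinearEquiv.integral_comp_comm (fun p => g' p w)
  rw [← h]
  refine hasFDerivAt_integral_of_dominated_of_fderiv_le (F' := fun x p => T (g' p x))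
    (Metric.ball_mem_nhds w one_pos) (.of_forall fun x => (hgm x).aestronglyMeasurable) (hgm w)
    (T.continuous.comp_aestronglyMeasurable hg'm) ?_ hb (.of_forall fun p x _ => hg p x)
  filter_upwards [hbd] with p hp x hx
  rw [T.norm_map]
  exact hp x hx

/-- Differentiation under the integral sign to all orders. -/
theorem hasFTaylorSeriesUpTo_integral {P V F : Type*} [MeasurableSpace P] {μ : Measure P}
    [NormedAddCommGroup V] [NormedSpace ℝ V] [NormedAddCommGroup F] [NormedSpace ℝ F]
    {g : P → V → F} (hg : ∀ p, ContDiff ℝ ∞ (g p))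
    (hm : ∀ n w, AEStronglyMeasurable (fun p => iteratedFDeriv ℝ n (g p) w) μ)
    {bound : P → ℝ} (hb : Integrable bound μ) {c : ℕ → ℝ → ℝ} (hc : ∀ n, Monotone (c n))
    (hbd : ∀ᵐ p ∂μ, 0 ≤ bound p ∧ ∀ n w, ‖iteratedFDeriv ℝ n (g p) w‖ ≤ c n ‖w‖ * bound p) :
    HasFTaylorSeriesUpTo ∞ (fun w => ∫ p, g p w ∂μ)
      (fun w n => ∫ p, iteratedFDeriv ℝ n (g p) w ∂μ) := by
  have hint (n : ℕ) (w : V) : Integrable (fun p => iteratedFDeriv ℝ n (g p) w) μ := by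
    refine (hb.const_mul (c n ‖w‖)).mono' (hm n w) ?_
    filter_upwards [hbd] with p hp using hp.2 n w
  refine (hasFTaylorSeriesUpTo_top_iff' le_rfl).2 ⟨fun w => ?_, fun n w => ?_⟩
  · have h := (continuousMultilinearCurryFin0 ℝ V F).toContinuousLinearEquiv.integral_comp_comm
      (fun p => iteratedFDeriv ℝ 0 (g p) w) (μ := μ)
    refine h.symm.trans ?_
    congr with p
  · refine hasFDerivAt_integral_of_isometryEquiv
      (continuousMultilinearCurryLeftEquiv ℝ (fun _ : Fin (n + 1) => V) F)
      (g := fun p x => iteratedFDeriv ℝ n (g p) x)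
      (g' := fun p x => iteratedFDeriv ℝ (n + 1) (g p) x) (fun p x => ?_) (hint n) w
      (hm (n + 1) w) (hb.const_mul (c (n + 1) (‖w‖ + 1))) ?_
    · exact (hg p).ftaylorSeries.fderiv n (by exact_mod_cast WithTop.coe_lt_top n) x
    · filter_upwards [hbd] with p hp x hx
      refine (hp.2 _ x).trans (mul_le_mul_of_nonneg_right (hc _ ?_) hp.1)
      have := norm_sub_norm_le x w
      rw [Metric.mem_ball, dist_eq_norm] at hx
      linarith

/-- The function `t ↦ 1 - cos t` vanishes to second order at the origin. -/
theorem abs_iteratedDeriv_one_sub_cos_le (n : ℕ) (t : ℝ) :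
    |iteratedDeriv n (fun t => 1 - Real.cos t) t| ≤ |t| ^ (2 - n) := by
  match n with
  | 0 =>
    simp only [iteratedDeriv_zero, Nat.sub_zero, sq_abs]
    rw [abs_of_nonneg (by linarith [Real.cos_le_one t])]
    nlinarith [Real.one_sub_sq_div_two_le_cos (x := t), sq_nonneg t]
  | 1 =>
    simp [Real.abs_sin_le_abs]
  | n + 2 =>
    have h : deriv (fun t => 1 - Real.cos t) = Real.sin := by ext; simp
    rw [iteratedDeriv_succ', h]
    simpa using Real.abs_iteratedDeriv_sin_le_one (n + 1) t

section Multiplier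

variable {V : Type*} [NormedAddCommGroup V] [NormedSpace ℝ V]

theorem iteratedFDeriv_const_mul_one_sub_cos (k : ℝ) (l : V →L[ℝ] ℝ) (n : ℕ) (w : V) :
    iteratedFDeriv ℝ n (fun w => k * (1 - Real.cos (l w))) w =
      k • (iteratedFDeriv ℝ n (fun t => 1 - Real.cos t) (l w)).compContinuousLinearMap
        (fun _ => l) := by
  have hG : ContDiff ℝ n (fun t => 1 - Real.cos t) := contDiff_const.sub Real.contDiff_cos
  rw [← l.iteratedFDeriv_comp_right hG w le_rfl]
  exact iteratedFDeriv_const_smul_apply (a := k) (hG.comp l.contDiff).contDiffAt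

theorem norm_iteratedFDeriv_const_mul_one_sub_cos_le (k : ℝ) (l : V →L[ℝ] ℝ) (hl : ‖l‖ ≤ 2)
    (n : ℕ) (w : V) :
    ‖iteratedFDeriv ℝ n (fun w => k * (1 - Real.cos (l w))) w‖ ≤
      (2 ^ n * (1 + ‖w‖) ^ (2 - n)) * (|k| * ‖l‖ ^ 2) := by
  rw [iteratedFDeriv_const_mul_one_sub_cos, norm_smul, Real.norm_eq_abs]
  have h1 := (iteratedFDeriv ℝ n (fun t => 1 - Real.cos t)
    (l w)).norm_compContinuousLinearMap_le (fun _ => l)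
  rw [norm_iteratedFDeriv_eq_norm_iteratedDeriv, Finset.prod_const, Finset.card_univ,
    Fintype.card_fin] at h1
  have h2 : |l w| ≤ ‖l‖ * (1 + ‖w‖) := (l.le_opNorm w).trans (by gcongr; linarith)
  have h3 : ‖l‖ ^ (2 - n) * ‖l‖ ^ n ≤ ‖l‖ ^ 2 * 2 ^ n := by
    rcases le_total n 2 with h | h
    · rw [← pow_add, Nat.sub_add_cancel h]
      exact le_mul_of_one_le_right (by positivity) (one_le_pow₀ one_le_two)
    · rw [Nat.sub_eq_zero_of_le h, pow_zero, one_mul]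
      calc ‖l‖ ^ n = ‖l‖ ^ 2 * ‖l‖ ^ (n - 2) := by rw [← pow_add, Nat.add_sub_cancel' h]
        _ ≤ ‖l‖ ^ 2 * 2 ^ (n - 2) := by gcongr
        _ ≤ _ := by gcongr; exacts [one_le_two, Nat.sub_le _ _]
  calc _ ≤ |k| * (|l w| ^ (2 - n) * ‖l‖ ^ n) := by
        gcongr
        refine h1.trans ?_
        gcongr
        exact abs_iteratedDeriv_one_sub_cos_le n _
    _ ≤ |k| * ((‖l‖ * (1 + ‖w‖)) ^ (2 - n) * ‖l‖ ^ n) := by gcongr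
    _ = |k| * (1 + ‖w‖) ^ (2 - n) * (‖l‖ ^ (2 - n) * ‖l‖ ^ n) := by rw [mul_pow]; ring
    _ ≤ |k| * (1 + ‖w‖) ^ (2 - n) * (‖l‖ ^ 2 * 2 ^ n) := by gcongr
    _ = _ := by ring

theorem aestronglyMeasurable_iteratedFDeriv_const_mul_one_sub_cos {P : Type*} [MeasurableSpace P]
    {μ : Measure P} {k : P → ℝ} {l : P → V →L[ℝ] ℝ} (hk : AEStronglyMeasurable k μ)
    (hl : AEStronglyMeasurable l μ) (n : ℕ) (w : V) :
    AEStronglyMeasurable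
      (fun p => iteratedFDeriv ℝ n (fun w => k p * (1 - Real.cos (l p w))) w) μ := by
  simp_rw [iteratedFDeriv_const_mul_one_sub_cos]
  refine hk.smul ?_
  have hG : Continuous (iteratedFDeriv ℝ n (fun t => 1 - Real.cos t)) :=
    ContDiff.continuous_iteratedFDeriv (n := n) le_rfl (contDiff_const.sub Real.contDiff_cos)
  have hcomp : Continuous fun l : V →L[ℝ] ℝ =>
      (iteratedFDeriv ℝ n (fun t => 1 - Real.cos t) (l w)).compContinuousLinearMap
        (fun _ => l) := by
    change Continuous fun l : V →L[ℝ] ℝ =>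
      (ContinuousMultilinearMap.compContinuousLinearMapContinuousMultilinear ℝ
        (fun _ : Fin n => V) (fun _ : Fin n => ℝ) ℝ (fun _ => l))
        (iteratedFDeriv ℝ n (fun t => 1 - Real.cos t) (l w))
    refine Continuous.clm_apply ?_ (hG.comp (by fun_prop))
    exact (ContinuousMultilinearMap.cont _).comp (by fun_prop)
  exact hcomp.comp_aestronglyMeasurable hl

/-- A Lévy-Khintchine type integral of `1 - cos` is smooth, and all its derivatives of positive
order grow at most linearly. -/
theorem contDiff_integral_one_sub_cos {P : Type*} [MeasurableSpace P] {μ : Measure P}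
    {k : P → ℝ} {l : P → V →L[ℝ] ℝ} (hk : AEStronglyMeasurable k μ)
    (hl : AEStronglyMeasurable l μ) {bound : P → ℝ} (hb : Integrable bound μ)
    (hl2 : ∀ᵐ p ∂μ, ‖l p‖ ≤ 2) (hkl : ∀ᵐ p ∂μ, |k p| * ‖l p‖ ^ 2 ≤ bound p) :
    ContDiff ℝ ∞ (fun w => ∫ p, k p * (1 - Real.cos (l p w)) ∂μ) ∧
    ∀ n, 1 ≤ n → ∀ w,
      ‖iteratedFDeriv ℝ n (fun w => ∫ p, k p * (1 - Real.cos (l p w)) ∂μ) w‖ ≤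
        2 ^ n * (1 + ‖w‖) * ∫ p, bound p ∂μ := by
  have hbd : ∀ᵐ p ∂μ, 0 ≤ bound p ∧ ∀ n w,
      ‖iteratedFDeriv ℝ n (fun w => k p * (1 - Real.cos (l p w))) w‖ ≤
        (2 ^ n * (1 + max 0 ‖w‖) ^ (2 - n)) * bound p := by
    filter_upwards [hl2, hkl] with p h2 hp
    refine ⟨le_trans (by positivity) hp, fun n w => ?_⟩
    rw [max_eq_right (norm_nonneg w)]
    refine (norm_iteratedFDeriv_const_mul_one_sub_cos_le _ _ h2 n w).trans ?_
    gcongr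
  have H := hasFTaylorSeriesUpTo_integral (μ := μ)
    (g := fun p w => k p * (1 - Real.cos (l p w)))
    (fun p => contDiff_const.mul (contDiff_const.sub (Real.contDiff_cos.comp (l p).contDiff)))
    (fun n w => aestronglyMeasurable_iteratedFDeriv_const_mul_one_sub_cos hk hl n w) hb
    (c := fun n r => 2 ^ n * (1 + max 0 r) ^ (2 - n))
    (fun n r s hrs => by dsimp only; gcongr) hbd
  refine ⟨H.contDiff, fun n hn w => ?_⟩
  rw [← H.eq_iteratedFDeriv (by exact_mod_cast le_top) w, ← integral_const_mul]
  refine norm_integral_le_of_norm_le (hb.const_mul _) ?_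
  filter_upwards [hbd] with p hp
  refine (hp.2 n w).trans ?_
  rw [max_eq_right (norm_nonneg w)]
  have := hp.1
  gcongr
  calc (1 + ‖w‖) ^ (2 - n) ≤ (1 + ‖w‖) ^ 1 :=
        pow_le_pow_right₀ (by linarith [norm_nonneg w]) (by omega)
    _ = _ := pow_one _

end Multiplier

section Symbol

variable {d : ℕ} {α : ℝ} {κ : EuclideanSpace ℝ (Fin d) → ℝ} {κ₁ : ℝ}

theorem integrableOn_norm_sq_mul_norm_rpow (hd : 1 ≤ d) (hα : α < 2) :
    IntegrableOn (fun y : EuclideanSpace ℝ (Fin d) => ‖y‖ ^ 2 * ‖y‖ ^ (-(d : ℝ) - α))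
      {y | ‖y‖ ≤ 1} := by
  have h := integrableOn_ball_of_norm_le_rpow (E := EuclideanSpace ℝ (Fin d)) (μ := volume)
    (f := fun y => ‖y‖ ^ 2 * ‖y‖ ^ (-(d : ℝ) - α)) (C := 1) (α := d + α - 2) (r := 2)
    (by simpa using hd) (by simp; linarith) (.of_forall fun y => ?_)
    (by fun_prop)
  · refine h.mono_set fun y hy => ?_
    rw [mem_ball_zero_iff]
    exact lt_of_le_of_lt (show ‖y‖ ≤ 1 from hy) one_lt_two
  · rcases (norm_nonneg y).eq_or_lt with h0 | h0
    · rw [← h0]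
      simp only [ne_eq, OfNat.ofNat_ne_zero, not_false_eq_true, zero_pow, zero_mul, norm_zero,
        one_mul]
      positivity
    · rw [Real.norm_of_nonneg (by positivity), ← Real.rpow_natCast, ← Real.rpow_add h0, one_mul]
      refine le_of_eq (congrArg _ ?_)
      push_cast
      ring

theorem measurableSet_norm_le_one : MeasurableSet {y : EuclideanSpace ℝ (Fin d) | ‖y‖ ≤ 1} :=
  measurableSet_le measurable_norm measurable_const

theorem continuous_psiK (hd : 1 ≤ d) (hα : α < 2) (hκm : Measurable κ)
    (hκ : ∀ y, 1 ≤ κ y ∧ κ y ≤ κ₁) : Continuous (psiK d α κ) := by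
  have h := (contDiff_integral_one_sub_cos (P := EuclideanSpace ℝ (Fin d))
    (μ := volume.restrict {y | ‖y‖ ≤ 1}) (k := fun y => κ y * ‖y‖ ^ (-(d : ℝ) - α))
    (l := fun y : EuclideanSpace ℝ (Fin d) => innerSL ℝ y)
    (bound := fun y => κ₁ * (‖y‖ ^ 2 * ‖y‖ ^ (-(d : ℝ) - α)))
    (by fun_prop) (innerSL ℝ (E := EuclideanSpace ℝ (Fin d))).continuous.aestronglyMeasurable
    ((integrableOn_norm_sq_mul_norm_rpow hd hα).const_mul _) ?_ (.of_forall fun y => ?_)).1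
  · have h' : psiK d α κ = fun ζ => ∫ y in {y : EuclideanSpace ℝ (Fin d) | ‖y‖ ≤ 1},
        κ y * ‖y‖ ^ (-(d : ℝ) - α) * (1 - Real.cos (innerSL ℝ y ζ)) := by
      ext ζ
      rw [psiK]
      refine integral_congr_ae (.of_forall fun y => ?_)
      simp only [innerSL_apply_apply, real_inner_comm]
      ring
    rw [h']
    exact h.continuous
  · refine ae_restrict_of_forall_mem measurableSet_norm_le_one fun y hy => ?_
    rw [innerSL_apply_norm]
    exact le_trans (show ‖y‖ ≤ 1 from hy) one_le_two
  · rw [innerSL_apply_norm, abs_mul, abs_of_nonneg (by linarith [(hκ y).1]),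
      abs_of_nonneg (by positivity)]
    calc _ = κ y * (‖y‖ ^ 2 * ‖y‖ ^ (-(d : ℝ) - α)) := by ring
      _ ≤ _ := by gcongr; exact (hκ y).2

theorem integrableOn_psiK_integrand (hd : 1 ≤ d) (hα : α < 2) (hκm : Measurable κ)
    (hκ : ∀ y, 1 ≤ κ y ∧ κ y ≤ κ₁) (ζ : EuclideanSpace ℝ (Fin d)) :
    IntegrableOn (fun y => (1 - Real.cos ⟪ζ, y⟫) * κ y * ‖y‖ ^ (-(d : ℝ) - α)) {y | ‖y‖ ≤ 1} := by
  refine ((integrableOn_norm_sq_mul_norm_rpow hd hα).const_mul (‖ζ‖ ^ 2 * κ₁)).mono'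
    (by fun_prop) (.of_forall fun y => ?_)
  have h1 := Real.cos_le_one ⟪ζ, y⟫
  have h2 : 1 - Real.cos ⟪ζ, y⟫ ≤ ‖ζ‖ ^ 2 * ‖y‖ ^ 2 := by
    have := Real.one_sub_sq_div_two_le_cos (x := ⟪ζ, y⟫)
    have h3 : ⟪ζ, y⟫ ^ 2 ≤ (‖ζ‖ * ‖y‖) ^ 2 := sq_le_sq' (by
      linarith [neg_abs_le ⟪ζ, y⟫, abs_real_inner_le_norm ζ y]) (real_inner_le_norm ζ y)
    nlinarith [sq_nonneg ⟪ζ, y⟫]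
  have hκ0 : 0 ≤ κ y := by linarith [(hκ y).1]
  rw [Real.norm_of_nonneg (mul_nonneg (mul_nonneg (by linarith) hκ0) (by positivity))]
  calc _ ≤ (‖ζ‖ ^ 2 * ‖y‖ ^ 2) * κ₁ * ‖y‖ ^ (-(d : ℝ) - α) := by
        gcongr
        exact (hκ y).2
    _ = _ := by ring

theorem psiK_nonneg (hκ : ∀ y, 1 ≤ κ y ∧ κ y ≤ κ₁) (ζ : EuclideanSpace ℝ (Fin d)) :
    0 ≤ psiK d α κ ζ :=
  integral_nonneg fun y => mul_nonneg (mul_nonneg (by linarith [Real.cos_le_one ⟪ζ, y⟫])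
    (by linarith [(hκ y).1])) (by positivity)

theorem exists_le_psiK_of_one_le_norm (hd : 1 ≤ d) (hα : α ∈ Set.Ioo (0 : ℝ) 2) :
    ∃ c > (0 : ℝ), ∀ (κ : EuclideanSpace ℝ (Fin d) → ℝ) (κ₁ : ℝ), Measurable κ →
      (∀ y, 1 ≤ κ y ∧ κ y ≤ κ₁) → ∀ ζ, 1 ≤ ‖ζ‖ → c * ‖ζ‖ ^ α ≤ psiK d α κ ζ := by
  set v := (volume : Measure (EuclideanSpace ℝ (Fin d))).real (Metric.ball 0 1) with hv
  have hv0 : 0 < v := ENNReal.toReal_pos (Metric.measure_ball_pos _ _ one_pos).ne'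
    measure_ball_lt_top.ne
  refine ⟨v / (8 * π ^ 2 * 4 ^ d), by positivity, fun κ κ₁ hκm hκ ζ hζ => ?_⟩
  have hζ0 : 0 < ‖ζ‖ := by linarith
  set r := ‖ζ‖⁻¹ with hr
  have hr0 : 0 < r := by positivity
  have hr1 : r ≤ 1 := inv_le_one_of_one_le₀ hζ
  have hrζ : ‖ζ‖ * r = 1 := mul_inv_cancel₀ hζ0.ne'
  set y₀ := (r ^ 2 / 2) • ζ with hy₀
  have hy₀n : ‖y₀‖ = r / 2 := by
    rw [hy₀, norm_smul, Real.norm_of_nonneg (by positivity)]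
    linear_combination r / 2 * hrζ
  have hy₀i : ⟪ζ, y₀⟫ = 1 / 2 := by
    rw [hy₀, real_inner_smul_right, real_inner_self_eq_norm_sq]
    linear_combination (‖ζ‖ * r + 1) / 2 * hrζ
  have key : ∀ y ∈ Metric.ball y₀ (r / 4), ‖y‖ ≤ r ∧ 0 < ‖y‖ ∧
      1 / 4 ≤ ⟪ζ, y⟫ ∧ ⟪ζ, y⟫ ≤ 1 := by
    intro y hy
    rw [Metric.mem_ball, dist_eq_norm] at hy
    have h1 : ‖y‖ ≤ ‖y₀‖ + ‖y - y₀‖ := by simpa using norm_add_le y₀ (y - y₀)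
    have h2 : ⟪ζ, y⟫ = 1 / 2 + ⟪ζ, y - y₀⟫ := by rw [inner_sub_right, hy₀i]; ring
    have h3 : |⟪ζ, y - y₀⟫| ≤ 1 / 4 := by
      refine (abs_real_inner_le_norm _ _).trans ?_
      calc ‖ζ‖ * ‖y - y₀‖ ≤ ‖ζ‖ * (r / 4) := by gcongr
        _ = 1 / 4 := by linear_combination hrζ / 4
    have h4 := abs_le.1 h3
    refine ⟨by linarith, ?_, by linarith, by linarith⟩
    rw [norm_pos_iff]
    rintro rfl
    rw [inner_zero_right] at h2
    linarith
  have hsub : Metric.ball y₀ (r / 4) ⊆ {y | ‖y‖ ≤ 1} := fun y hy => (key y hy).1.trans hr1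
  have hint := integrableOn_psiK_integrand (α := α) hd hα.2 hκm hκ ζ
  have hlow : ∀ y ∈ Metric.ball y₀ (r / 4), 1 / (8 * π ^ 2) * r ^ (-(d : ℝ) - α) ≤
      (1 - Real.cos ⟪ζ, y⟫) * κ y * ‖y‖ ^ (-(d : ℝ) - α) := by
    intro y hy
    obtain ⟨h1, h2, h3, h4⟩ := key y hy
    have h5 : 1 / (8 * π ^ 2) ≤ 1 - Real.cos ⟪ζ, y⟫ := by
      have h6 := Real.cos_le_one_sub_mul_cos_sq (x := ⟪ζ, y⟫)
        (by rw [abs_of_nonneg (by linarith)]; linarith [Real.pi_gt_three])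
      have h7 : 1 / (8 * π ^ 2) ≤ 2 / π ^ 2 * ⟪ζ, y⟫ ^ 2 := by
        calc 1 / (8 * π ^ 2) = 2 / π ^ 2 * (1 / 4) ^ 2 := by field_simp; norm_num
          _ ≤ _ := by gcongr
      linarith
    have h8 : r ^ (-(d : ℝ) - α) ≤ ‖y‖ ^ (-(d : ℝ) - α) :=
      Real.rpow_le_rpow_of_nonpos h2 h1 (by have := hα.1; have : (0 : ℝ) ≤ d := by positivity
                                            linarith)
    calc _ = 1 / (8 * π ^ 2) * 1 * r ^ (-(d : ℝ) - α) := by ring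
      _ ≤ _ := by
        gcongr
        · exact mul_nonneg (by linarith [Real.cos_le_one ⟪ζ, y⟫]) (by linarith [(hκ y).1])
        · linarith [Real.cos_le_one ⟪ζ, y⟫]
        · exact (hκ y).1
  calc v / (8 * π ^ 2 * 4 ^ d) * ‖ζ‖ ^ α
      = ∫ y in Metric.ball y₀ (r / 4), 1 / (8 * π ^ 2) * r ^ (-(d : ℝ) - α) := by
        rw [setIntegral_const, measureReal_def, Measure.addHaar_ball_of_pos _ _ (by positivity),
          ENNReal.toReal_mul, ENNReal.toReal_ofReal (by positivity), finrank_euclideanSpace,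
          Fintype.card_fin, ← measureReal_def, ← hv, hr, Real.inv_rpow hζ0.le,
          ← Real.rpow_neg hζ0.le, smul_eq_mul,
          show -(-(d : ℝ) - α) = α + d by ring, Real.rpow_add hζ0, Real.rpow_natCast]
        field_simp
        rw [← mul_pow, ← mul_pow, show 4 * (1 / (‖ζ‖ * 4)) * ‖ζ‖ = 1 by field_simp, one_pow]
    _ ≤ ∫ y in Metric.ball y₀ (r / 4),
          (1 - Real.cos ⟪ζ, y⟫) * κ y * ‖y‖ ^ (-(d : ℝ) - α) :=
        setIntegral_mono_on (integrableOn_const measure_ball_lt_top.ne) (hint.mono_set hsub)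
          measurableSet_ball hlow
    _ ≤ _ := by
        refine setIntegral_mono_set hint (.of_forall fun y => ?_) hsub.eventuallyLE
        exact mul_nonneg (mul_nonneg (by linarith [Real.cos_le_one ⟪ζ, y⟫])
          (by linarith [(hκ y).1])) (by positivity)

theorem norm_prod_le_four_mul_max {E : Type*} [NormedAddCommGroup E] [NormedSpace ℝ E]
    (w : E × E) {s : ℝ} (hs : s ∈ Set.Icc (0 : ℝ) (1 / 2)) :
    ‖w‖ ≤ 4 * max ‖s • w.1 + w.2‖ ‖(s + 1 / 2) • w.1 + w.2‖ := by
  set a := s • w.1 + w.2 with ha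
  set b := (s + 1 / 2) • w.1 + w.2 with hb
  have h1 : w.1 = (2 : ℝ) • (b - a) := by rw [ha, hb]; module
  have h2 : w.2 = a - s • w.1 := by rw [ha]; module
  have h3 : ‖w.1‖ ≤ 2 * (‖b‖ + ‖a‖) := by
    rw [h1, norm_smul, Real.norm_ofNat]
    gcongr
    exact norm_sub_le _ _
  have h4 : ‖w.2‖ ≤ ‖a‖ + 1 / 2 * ‖w.1‖ := by
    calc ‖w.2‖ = ‖a - s • w.1‖ := by rw [← h2]
      _ ≤ ‖a‖ + ‖s • w.1‖ := norm_sub_le _ _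
      _ ≤ _ := by
        rw [norm_smul, Real.norm_of_nonneg hs.1]
        gcongr
        exact hs.2
  have := le_max_left ‖a‖ ‖b‖
  have := le_max_right ‖a‖ ‖b‖
  exact max_le (by linarith) (by linarith [norm_nonneg a])

theorem exists_le_phiK (hd : 1 ≤ d) (hα : α ∈ Set.Ioo (0 : ℝ) 2) :
    ∃ c > (0 : ℝ), ∃ b : ℝ, ∀ (κ : EuclideanSpace ℝ (Fin d) → ℝ) (κ₁ : ℝ), Measurable κ →
      (∀ y, 1 ≤ κ y ∧ κ y ≤ κ₁) → ∀ w, c * ‖w‖ ^ α - b ≤ phiK d α κ w := by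
  obtain ⟨c, hc, H⟩ := exists_le_psiK_of_one_le_norm hd hα
  refine ⟨c / 2 * (1 / 4) ^ α, by positivity, c / 2, fun κ κ₁ hκm hκ w => ?_⟩
  have hψ : ∀ ζ, c * ‖ζ‖ ^ α - c ≤ psiK d α κ ζ := by
    intro ζ
    rcases le_total 1 ‖ζ‖ with h | h
    · linarith [H κ κ₁ hκm hκ ζ h]
    · have := Real.rpow_le_one (norm_nonneg ζ) h hα.1.le
      nlinarith [psiK_nonneg (α := α) hκ ζ]
  have hcont : Continuous fun s : ℝ => psiK d α κ (s • w.1 + w.2) :=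
    (continuous_psiK hd hα.2 hκm hκ).comp (by fun_prop)
  have hcont' : Continuous fun s : ℝ => psiK d α κ ((s + 1 / 2) • w.1 + w.2) :=
    hcont.comp (continuous_add_const (1 / 2 : ℝ))
  have hsplit : phiK d α κ w = ∫ s in (0 : ℝ)..(1 / 2),
      (psiK d α κ (s • w.1 + w.2) + psiK d α κ ((s + 1 / 2) • w.1 + w.2)) := by
    rw [intervalIntegral.integral_add (hcont.intervalIntegrable _ _)
      (hcont'.intervalIntegrable _ _),
      intervalIntegral.integral_comp_add_right (fun s => psiK d α κ (s • w.1 + w.2)),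
      show (0 : ℝ) + 1 / 2 = 1 / 2 by norm_num, show (1 / 2 : ℝ) + 1 / 2 = 1 by norm_num,
      intervalIntegral.integral_add_adjacent_intervals (hcont.intervalIntegrable _ _)
        (hcont.intervalIntegrable _ _)]
    rfl
  calc c / 2 * (1 / 4) ^ α * ‖w‖ ^ α - c / 2
      = ∫ s in (0 : ℝ)..(1 / 2), (c * (1 / 4 * ‖w‖) ^ α - c) := by
        rw [intervalIntegral.integral_const, Real.mul_rpow (by norm_num) (norm_nonneg _),
          smul_eq_mul]
        ring
    _ ≤ _ := by
        rw [hsplit]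
        refine intervalIntegral.integral_mono_on (by norm_num) intervalIntegrable_const
          ((hcont.add hcont').intervalIntegrable _ _) fun s hs => ?_
        have h1 := norm_prod_le_four_mul_max w hs
        have h2 := psiK_nonneg (α := α) hκ (s • w.1 + w.2)
        have h3 := psiK_nonneg (α := α) hκ ((s + 1 / 2) • w.1 + w.2)
        have h4 := hψ (s • w.1 + w.2)
        have h5 := hψ ((s + 1 / 2) • w.1 + w.2)
        rcases max_cases ‖s • w.1 + w.2‖ ‖(s + 1 / 2) • w.1 + w.2‖ with ⟨h, -⟩ | ⟨h, -⟩ <;>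
          rw [h] at h1
        · have : (1 / 4 * ‖w‖) ^ α ≤ ‖s • w.1 + w.2‖ ^ α :=
            Real.rpow_le_rpow (by positivity) (by linarith) hα.1.le
          nlinarith
        · have : (1 / 4 * ‖w‖) ^ α ≤ ‖(s + 1 / 2) • w.1 + w.2‖ ^ α :=
            Real.rpow_le_rpow (by positivity) (by linarith) hα.1.le
          nlinarith

/-- The linear form `w ↦ ⟪y, s w₁ + w₂⟫`. -/
noncomputable def kineticForm (p : ℝ × EuclideanSpace ℝ (Fin d)) :
    EuclideanSpace ℝ (Fin d) × EuclideanSpace ℝ (Fin d) →L[ℝ] ℝ :=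
  (innerSL ℝ p.2).comp (p.1 • ContinuousLinearMap.fst ℝ _ _ + ContinuousLinearMap.snd ℝ _ _)

theorem norm_kineticForm_le {p : ℝ × EuclideanSpace ℝ (Fin d)} (hp : p.1 ∈ Set.Ioc (0 : ℝ) 1) :
    ‖kineticForm p‖ ≤ 2 * ‖p.2‖ := by
  refine ContinuousLinearMap.opNorm_le_bound _ (by positivity) fun w => ?_
  refine (norm_inner_le_norm (𝕜 := ℝ) p.2 (p.1 • w.1 + w.2)).trans ?_
  have h1 : ‖p.1 • w.1 + w.2‖ ≤ 1 * ‖w‖ + ‖w‖ := by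
    refine (norm_add_le _ _).trans (add_le_add ?_ (norm_snd_le w))
    rw [norm_smul, Real.norm_of_nonneg hp.1.le]
    gcongr
    exacts [hp.2, norm_fst_le w]
  calc _ ≤ ‖p.2‖ * (1 * ‖w‖ + ‖w‖) := by gcongr
    _ = _ := by ring

theorem exists_norm_iteratedFDeriv_phiK_le (hd : 1 ≤ d) (hα : α < 2) :
    ∃ A ≥ (0 : ℝ), ∀ (κ : EuclideanSpace ℝ (Fin d) → ℝ) (κ₁ : ℝ), Measurable κ →
      (∀ y, 1 ≤ κ y ∧ κ y ≤ κ₁) → ContDiff ℝ ∞ (phiK d α κ) ∧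
      ∀ n, 1 ≤ n → ∀ w,
        ‖iteratedFDeriv ℝ n (phiK d α κ) w‖ ≤ 2 ^ n * (1 + ‖w‖) * (κ₁ * A) := by
  set μ : Measure (ℝ × EuclideanSpace ℝ (Fin d)) :=
    (volume.restrict (Set.Ioc 0 1)).prod (volume.restrict {y | ‖y‖ ≤ 1}) with hμ
  have hint : Integrable (fun p : ℝ × EuclideanSpace ℝ (Fin d) =>
      4 * (‖p.2‖ ^ 2 * ‖p.2‖ ^ (-(d : ℝ) - α))) μ :=
    ((integrableOn_norm_sq_mul_norm_rpow hd hα).integrable.comp_snd _).const_mul 4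
  refine ⟨∫ p, 4 * (‖p.2‖ ^ 2 * ‖p.2‖ ^ (-(d : ℝ) - α)) ∂μ,
    integral_nonneg fun p => by positivity, fun κ κ₁ hκm hκ => ?_⟩
  have hae {q : ℝ × EuclideanSpace ℝ (Fin d) → Prop}
      (hq : ∀ p : ℝ × EuclideanSpace ℝ (Fin d), p.1 ∈ Set.Ioc (0 : ℝ) 1 → ‖p.2‖ ≤ 1 → q p) :
      ∀ᵐ p ∂μ, q p := by
    rw [hμ, Measure.prod_restrict]
    exact ae_restrict_of_forall_mem (measurableSet_Ioc.prod measurableSet_norm_le_one)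
      fun p hp => hq p hp.1 hp.2
  have hl : Continuous (kineticForm (d := d)) := by
    unfold kineticForm
    fun_prop
  have hk : ∀ᵐ p ∂μ, |κ p.2 * ‖p.2‖ ^ (-(d : ℝ) - α)| * ‖kineticForm p‖ ^ 2 ≤
      κ₁ * (4 * (‖p.2‖ ^ 2 * ‖p.2‖ ^ (-(d : ℝ) - α))) := hae fun p hp _ => by
    rw [abs_mul, abs_of_nonneg (by linarith [(hκ p.2).1]), abs_of_nonneg (by positivity)]
    have hκ0 : 0 ≤ κ₁ := by linarith [(hκ p.2).1, (hκ p.2).2]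
    calc _ ≤ κ₁ * ‖p.2‖ ^ (-(d : ℝ) - α) * (2 * ‖p.2‖) ^ 2 := by
          gcongr
          exacts [(hκ p.2).2, norm_kineticForm_le hp]
      _ = _ := by ring
  have hkm : AEStronglyMeasurable (fun p : ℝ × EuclideanSpace ℝ (Fin d) =>
      κ p.2 * ‖p.2‖ ^ (-(d : ℝ) - α)) μ := by fun_prop
  have hmain := contDiff_integral_one_sub_cos hkm hl.aestronglyMeasurable (hint.const_mul κ₁)
    (hae fun p hp hp' => (norm_kineticForm_le hp).trans (by linarith)) hk
  have hphi : phiK d α κ = fun w =>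
      ∫ p, κ p.2 * ‖p.2‖ ^ (-(d : ℝ) - α) * (1 - Real.cos (kineticForm p w)) ∂μ := by
    ext w
    rw [integral_prod, phiK, intervalIntegral.integral_of_le zero_le_one]
    · refine integral_congr_ae (.of_forall fun s => integral_congr_ae (.of_forall fun y => ?_))
      simp only [kineticForm, ContinuousLinearMap.comp_apply, innerSL_apply_apply,
        add_apply, smul_apply,
        ContinuousLinearMap.coe_fst', ContinuousLinearMap.coe_snd', real_inner_comm]
      ring
    · refine ((hint.const_mul κ₁).const_mul ((1 + ‖w‖) ^ 2)).mono' ?_ ?_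
      · exact hkm.mul (Continuous.aestronglyMeasurable (by fun_prop))
      · filter_upwards [hk, hae (q := fun p => ‖kineticForm p‖ ≤ 2)
          fun p hp hp' => (norm_kineticForm_le hp).trans (by linarith)] with p hp hp2
        have := norm_iteratedFDeriv_const_mul_one_sub_cos_le
          (κ p.2 * ‖p.2‖ ^ (-(d : ℝ) - α)) (kineticForm p) hp2 0 w
        rw [norm_iteratedFDeriv_zero, pow_zero, one_mul] at this
        refine this.trans ?_
        gcongr
  rw [hphi, ← integral_const_mul]
  exact hmain

end Symbol

theorem exists_one_add_pow_mul_exp_neg_mul_rpow_le {c α : ℝ} (hc : 0 < c) (hα : 0 < α) (N : ℕ) :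
    ∃ C ≥ (0 : ℝ), ∀ x : ℝ, 0 ≤ x → (1 + x) ^ N * Real.exp (-(c * x ^ α)) ≤ C := by
  obtain ⟨m, hm⟩ := exists_nat_ge (N / α)
  rw [div_le_iff₀ hα] at hm
  refine ⟨2 ^ N * (1 + m.factorial / c ^ m), by positivity, fun x hx => ?_⟩
  have hexp : 0 < Real.exp (-(c * x ^ α)) := Real.exp_pos _
  rcases le_total x 1 with h | h
  · have h1 : Real.exp (-(c * x ^ α)) ≤ 1 := Real.exp_le_one_iff.2 (by
      have : 0 ≤ c * x ^ α := by positivity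
      linarith)
    calc (1 + x) ^ N * Real.exp (-(c * x ^ α)) ≤ 2 ^ N * 1 := by gcongr; linarith
      _ ≤ _ := by
        gcongr
        exact le_add_of_nonneg_right (by positivity)
  · have h1 : (x ^ α) ^ m * c ^ m ≤ m.factorial * Real.exp (c * x ^ α) := by
      have := Real.pow_div_factorial_le_exp (c * x ^ α) (by positivity) m
      rw [div_le_iff₀ (by positivity), mul_pow] at this
      linarith
    have h2 : x ^ N ≤ (x ^ α) ^ m := by
      rw [← Real.rpow_natCast, ← Real.rpow_natCast, ← Real.rpow_mul hx]
      exact Real.rpow_le_rpow_of_exponent_le h (by linarith)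
    have h3 : (1 + x) ^ N ≤ 2 ^ N * (m.factorial / c ^ m * Real.exp (c * x ^ α)) := by
      calc (1 + x) ^ N ≤ (2 * x) ^ N := by gcongr; linarith
        _ = 2 ^ N * x ^ N := mul_pow _ _ _
        _ ≤ _ := by
          gcongr
          rw [div_mul_eq_mul_div, le_div_iff₀ (by positivity)]
          exact le_trans (by gcongr) h1
    calc (1 + x) ^ N * Real.exp (-(c * x ^ α))
        ≤ 2 ^ N * (m.factorial / c ^ m * Real.exp (c * x ^ α)) * Real.exp (-(c * x ^ α)) := by
          gcongr
      _ = 2 ^ N * (m.factorial / c ^ m) := by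
          rw [Real.exp_neg]
          field_simp
      _ ≤ _ := by
        gcongr
        linarith

theorem norm_iteratedFDeriv_exp_neg_le {V : Type*} [NormedAddCommGroup V] [NormedSpace ℝ V]
    {φ : V → ℝ} (hφ : ContDiff ℝ ∞ φ) {n : ℕ} {w : V} {D : ℝ}
    (hD : ∀ i, 1 ≤ i → i ≤ n → ‖iteratedFDeriv ℝ i φ w‖ ≤ D ^ i) :
    ‖iteratedFDeriv ℝ n (fun w => Real.exp (-φ w)) w‖ ≤
      n.factorial * Real.exp (-φ w) * D ^ n := by
  refine norm_iteratedFDeriv_comp_le (g := fun t => Real.exp (-t)) (N := ∞) (by fun_prop) hφ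
    (mod_cast le_top) w (fun i _ => ?_) hD
  rw [norm_iteratedFDeriv_eq_norm_iteratedDeriv, iteratedDeriv_comp_neg, iteratedDeriv_eq_iterate,
    Real.iter_deriv_exp, norm_smul, norm_pow, norm_neg, norm_one, one_pow, one_mul,
    Real.norm_of_nonneg (Real.exp_pos _).le]

theorem exists_integral_norm_pow_mul_norm_iteratedFDeriv_exp_neg_phiK_le {d : ℕ} {α : ℝ}
    (hd : 1 ≤ d) (hα : α ∈ Set.Ioo (0 : ℝ) 2) (k n : ℕ) :
    ∃ K ≥ (0 : ℝ), ∀ (κ : EuclideanSpace ℝ (Fin d) → ℝ) (κ₁ : ℝ), 1 ≤ κ₁ → Measurable κ →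
      (∀ y, 1 ≤ κ y ∧ κ y ≤ κ₁) →
      Integrable (fun w =>
        ‖w‖ ^ k * ‖iteratedFDeriv ℝ n (fun w => Real.exp (-phiK d α κ w)) w‖) ∧
      ∫ w, ‖w‖ ^ k * ‖iteratedFDeriv ℝ n (fun w => Real.exp (-phiK d α κ w)) w‖ ≤
        K * κ₁ ^ n := by
  obtain ⟨c, hc, b, hlow⟩ := exists_le_phiK hd hα
  obtain ⟨A, hA, hder⟩ := exists_norm_iteratedFDeriv_phiK_le (d := d) hd hα.2
  obtain ⟨C, hC, hdecay⟩ := exists_one_add_pow_mul_exp_neg_mul_rpow_le hc hα.1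
    (k + n + (2 * d + 1))
  have : (volume : Measure (EuclideanSpace ℝ (Fin d) × EuclideanSpace ℝ (Fin d))).IsAddHaarMeasure
    := Measure.prod.instIsAddHaarMeasure _ _
  have hint : Integrable fun w : EuclideanSpace ℝ (Fin d) × EuclideanSpace ℝ (Fin d) =>
      (1 + ‖w‖) ^ (-(2 * d + 1 : ℝ)) := integrable_one_add_norm (by
    rw [Module.finrank_prod, finrank_euclideanSpace, Fintype.card_fin]
    push_cast
    linarith)
  set M := n.factorial * Real.exp b * (2 * (1 + A)) ^ n * C with hM
  have hM0 : 0 ≤ M := by positivity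
  refine ⟨M * ∫ w : EuclideanSpace ℝ (Fin d) × EuclideanSpace ℝ (Fin d),
    (1 + ‖w‖) ^ (-(2 * d + 1 : ℝ)), mul_nonneg hM0 (integral_nonneg fun w => by positivity),
    fun κ κ₁ hκ₁ hκm hκ => ?_⟩
  obtain ⟨hφ, hφn⟩ := hder κ κ₁ hκm hκ
  have hbound (w : EuclideanSpace ℝ (Fin d) × EuclideanSpace ℝ (Fin d)) :
      ‖w‖ ^ k * ‖iteratedFDeriv ℝ n (fun w => Real.exp (-phiK d α κ w)) w‖ ≤
        κ₁ ^ n * M * (1 + ‖w‖) ^ (-(2 * d + 1 : ℝ)) := by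
    have h1 := norm_iteratedFDeriv_exp_neg_le (n := n) (w := w)
      (D := 2 * (1 + A) * κ₁ * (1 + ‖w‖)) hφ fun i hi _ => by
        refine (hφn i hi w).trans ?_
        have h2 : (1 : ℝ) ≤ (1 + A) * κ₁ * (1 + ‖w‖) :=
          one_le_mul_of_one_le_of_one_le
            (one_le_mul_of_one_le_of_one_le (by linarith) hκ₁) (by linarith [norm_nonneg w])
        calc 2 ^ i * (1 + ‖w‖) * (κ₁ * A) ≤ 2 ^ i * ((1 + A) * κ₁ * (1 + ‖w‖)) := by
              have : 0 ≤ 2 ^ i * (κ₁ * (1 + ‖w‖)) := by positivity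
              linarith
          _ ≤ 2 ^ i * ((1 + A) * κ₁ * (1 + ‖w‖)) ^ i := by
              gcongr
              exact le_self_pow₀ h2 (by lia)
          _ = _ := by rw [← mul_pow]; ring
    have h2 : Real.exp (-phiK d α κ w) ≤ Real.exp b * Real.exp (-(c * ‖w‖ ^ α)) := by
      rw [← Real.exp_add, Real.exp_le_exp]
      linarith [hlow κ κ₁ hκm hκ w]
    have hw : 0 < 1 + ‖w‖ := by positivity
    have h3 : (1 + ‖w‖) ^ (k + n) * Real.exp (-(c * ‖w‖ ^ α)) ≤
        C * (1 + ‖w‖) ^ (-(2 * d + 1 : ℝ)) := by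
      rw [Real.rpow_neg hw.le, ← div_eq_mul_inv, le_div_iff₀ (by positivity),
        show (2 * d + 1 : ℝ) = (2 * d + 1 : ℕ) by push_cast; rfl, Real.rpow_natCast]
      calc _ = (1 + ‖w‖) ^ (k + n + (2 * d + 1)) * Real.exp (-(c * ‖w‖ ^ α)) := by ring
        _ ≤ C := hdecay _ (norm_nonneg w)
    calc _ ≤ (1 + ‖w‖) ^ k * (n.factorial * (Real.exp b * Real.exp (-(c * ‖w‖ ^ α))) *
          (2 * (1 + A) * κ₁ * (1 + ‖w‖)) ^ n) := by
          gcongr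
          · linarith
          · exact h1.trans (by gcongr)
      _ = κ₁ ^ n * (n.factorial * Real.exp b * (2 * (1 + A)) ^ n) *
          ((1 + ‖w‖) ^ (k + n) * Real.exp (-(c * ‖w‖ ^ α))) := by
          rw [mul_pow, mul_pow]
          ring
      _ ≤ κ₁ ^ n * (n.factorial * Real.exp b * (2 * (1 + A)) ^ n) *
          (C * (1 + ‖w‖) ^ (-(2 * d + 1 : ℝ))) := by gcongr
      _ = _ := by rw [hM]; ring
  have hsmooth : ContDiff ℝ ∞ fun w => Real.exp (-phiK d α κ w) := hφ.neg.exp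
  have hi : Integrable fun w =>
      ‖w‖ ^ k * ‖iteratedFDeriv ℝ n (fun w => Real.exp (-phiK d α κ w)) w‖ := by
    refine (hint.const_mul (κ₁ ^ n * M)).mono' ?_ (.of_forall fun w => ?_)
    · exact ((continuous_norm.pow k).mul
        (hsmooth.continuous_iteratedFDeriv (mod_cast le_top)).norm).aestronglyMeasurable
    · rw [Real.norm_of_nonneg (by positivity)]
      exact hbound w
  refine ⟨hi, (integral_mono hi (hint.const_mul _) hbound).trans (le_of_eq ?_)⟩
  rw [integral_const_mul]
  ring

section CosTransform

set_option maxSynthPendingDepth 3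

variable {E : Type*} [NormedAddCommGroup E] [InnerProductSpace ℝ E]

variable (E) in
/-- The pairing `(v, w) ↦ (⟪v₁, w₁⟫ + ⟪v₂, w₂⟫) / (2π)`. -/
noncomputable def prodInnerSL : E × E →L[ℝ] E × E →L[ℝ] ℝ :=
  (2 * π)⁻¹ • ((innerSL ℝ).bilinearComp (ContinuousLinearMap.fst ℝ E E)
      (ContinuousLinearMap.fst ℝ E E) +
    (innerSL ℝ).bilinearComp (ContinuousLinearMap.snd ℝ E E) (ContinuousLinearMap.snd ℝ E E))

theorem prodInnerSL_apply (v w : E × E) :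
    prodInnerSL E v w = (2 * π)⁻¹ * (⟪v.1, w.1⟫ + ⟪v.2, w.2⟫) := rfl

variable [FiniteDimensional ℝ E] [MeasurableSpace E] [BorelSpace E]

theorem integral_cos_mul_eq_re_fourierIntegral {f : E × E → ℝ} (hf : Integrable f) (z : E × E) :
    ∫ w : E × E, Real.cos (⟪w.1, z.1⟫ + ⟪w.2, z.2⟫) * f w =
      Complex.reCLM (VectorFourier.fourierIntegral Real.fourierChar volume
        (prodInnerSL E).toLinearMap₁₂ (fun w => (f w : ℂ)) z) := by
  have hL : Continuous fun p : (E × E) × (E × E) => (prodInnerSL E).toLinearMap₁₂ p.1 p.2 :=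
    (prodInnerSL E).continuous₂
  have hfC : Integrable fun w => (f w : ℂ) := hf.ofReal
  rw [VectorFourier.fourierIntegral, ← Complex.reCLM.integral_comp_comm
    ((VectorFourier.fourierIntegral_convergent_iff Real.continuous_fourierChar hL z).2 hfC)]
  refine integral_congr_ae (.of_forall fun w => ?_)
  have h : 2 * π * (prodInnerSL E).toLinearMap₁₂ w z = ⟪w.1, z.1⟫ + ⟪w.2, z.2⟫ := by
    change 2 * π * prodInnerSL E w z = _
    rw [prodInnerSL_apply]
    field_simp
  simp only [Complex.reCLM_apply, Circle.smul_def, Real.fourierChar_apply, smul_eq_mul]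
  rw [mul_neg, h, Complex.re_mul_ofReal, Complex.exp_ofReal_mul_I_re, Real.cos_neg]

theorem contDiff_integral_cos_mul {f : E × E → ℝ} (hf : ContDiff ℝ ∞ f)
    (hint : ∀ k n : ℕ, Integrable fun w => ‖w‖ ^ k * ‖iteratedFDeriv ℝ n f w‖) :
    ContDiff ℝ ∞ (fun z : E × E => ∫ w : E × E, Real.cos (⟪w.1, z.1⟫ + ⟪w.2, z.2⟫) * f w) ∧
    ∀ (j n : ℕ) (z : E × E), √(‖z.1‖ ^ 2 + ‖z.2‖ ^ 2) ^ n *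
      ‖iteratedFDeriv ℝ j
        (fun z : E × E => ∫ w : E × E, Real.cos (⟪w.1, z.1⟫ + ⟪w.2, z.2⟫) * f w) z‖ ≤
      (2 * π) ^ n * (2 * π * ‖prodInnerSL E‖) ^ j * (2 * j + 2) ^ n *
        ∑ p ∈ Finset.range (j + 1) ×ˢ Finset.range (n + 1),
          ∫ w, ‖w‖ ^ p.1 * ‖iteratedFDeriv ℝ p.2 f w‖ := by
  have : (volume : Measure (E × E)).IsAddHaarMeasure := Measure.prod.instIsAddHaarMeasure _ _
  have hnorm (n : ℕ) (w : E × E) :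
      ‖iteratedFDeriv ℝ n (fun w => (f w : ℂ)) w‖ = ‖iteratedFDeriv ℝ n f w‖ :=
    Complex.ofRealLI.norm_iteratedFDeriv_comp_left hf.contDiffAt (mod_cast le_top)
  have hfC : ContDiff ℝ ∞ fun w => (f w : ℂ) := Complex.ofRealCLM.contDiff.comp hf
  have hintC (k n : ℕ) :
      Integrable fun w => ‖w‖ ^ k * ‖iteratedFDeriv ℝ n (fun w => (f w : ℂ)) w‖ := by
    simpa only [hnorm] using hint k n
  have hF : ContDiff ℝ ∞ (VectorFourier.fourierIntegral Real.fourierChar volume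
      (prodInnerSL E).toLinearMap₁₂ fun w => (f w : ℂ)) :=
    VectorFourier.contDiff_fourierIntegral _ fun n _ => by
      simpa only [norm_iteratedFDeriv_zero] using hintC n 0
  have hfi : Integrable f := by
    rw [← integrable_norm_iff hf.continuous.aestronglyMeasurable]
    simpa only [pow_zero, one_mul, norm_iteratedFDeriv_zero] using hint 0 0
  simp_rw [integral_cos_mul_eq_re_fourierIntegral hfi]
  refine ⟨Complex.reCLM.contDiff.comp hF, fun j n z => ?_⟩
  set r := √(‖z.1‖ ^ 2 + ‖z.2‖ ^ 2) with hr
  set S := ∑ p ∈ Finset.range (j + 1) ×ˢ Finset.range (n + 1),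
    ∫ w, ‖w‖ ^ p.1 * ‖iteratedFDeriv ℝ p.2 f w‖ with hS
  have hS0 : 0 ≤ S := Finset.sum_nonneg fun p _ => integral_nonneg fun w => by positivity
  have hr2 : r ^ 2 = ‖z.1‖ ^ 2 + ‖z.2‖ ^ 2 := Real.sq_sqrt (by positivity)
  have hzr : ‖z‖ ≤ r := max_le (Real.le_sqrt_of_sq_le (by nlinarith [sq_nonneg ‖z.2‖]))
    (Real.le_sqrt_of_sq_le (by nlinarith [sq_nonneg ‖z.1‖]))
  set X := ‖iteratedFDeriv ℝ j (VectorFourier.fourierIntegral Real.fourierChar volume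
    (prodInnerSL E).toLinearMap₁₂ fun w => (f w : ℂ)) z‖ with hX
  have hXle : ‖iteratedFDeriv ℝ j (fun z => Complex.reCLM (VectorFourier.fourierIntegral
      Real.fourierChar volume (prodInnerSL E).toLinearMap₁₂ (fun w => (f w : ℂ)) z)) z‖ ≤ X := by
    refine (Complex.reCLM.norm_iteratedFDeriv_comp_left hF.contDiffAt (mod_cast le_top)).trans ?_
    rw [Complex.reCLM_norm, one_mul]
  have hmain := VectorFourier.pow_mul_norm_iteratedFDeriv_fourierIntegral_le (K := ⊤) (N := ⊤)
    (prodInnerSL E) hfC (fun k n _ _ => hintC k n) (k := j) (n := n) le_top le_top z z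
  simp only [hnorm] at hmain
  rw [← hS, ← hX, prodInnerSL_apply, real_inner_self_eq_norm_sq, real_inner_self_eq_norm_sq,
    ← hr2, abs_of_nonneg (by positivity), mul_pow, inv_pow] at hmain
  set B := (2 * π * ‖prodInnerSL E‖) ^ j * (2 * j + 2) ^ n * S with hB
  have hB0 : 0 ≤ B := by positivity
  have hrn : r ^ n * X ≤ (2 * π) ^ n * B := by
    have h1 : r ^ n * (r ^ n * X) ≤ r ^ n * ((2 * π) ^ n * B) := by
      calc r ^ n * (r ^ n * X) = (2 * π) ^ n * (((2 * π) ^ n)⁻¹ * (r ^ 2) ^ n * X) := by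
            field_simp
            ring
        _ ≤ (2 * π) ^ n * (‖z‖ ^ n * B) := by
            refine mul_le_mul_of_nonneg_left (hmain.trans_eq ?_) (by positivity)
            rw [hB]
            ring
        _ ≤ (2 * π) ^ n * (r ^ n * B) := by gcongr
        _ = _ := by ring
    rcases (pow_nonneg (Real.sqrt_nonneg _ : 0 ≤ r) n).eq_or_lt with h0 | h0
    · rw [← h0, zero_mul]
      positivity
    · exact le_of_mul_le_mul_left h1 h0
  calc _ ≤ r ^ n * X := by gcongr
    _ ≤ _ := hrn
    _ = _ := by rw [hB]; ring

end CosTransform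

theorem le_mul_rpow_mul_one_add_rpow_neg {x r t C₀ C₁ β : ℝ} {N : ℕ} (hx : 0 ≤ x) (hr : 0 ≤ r)
    (ht : 1 ≤ t) (hβ : 0 ≤ β) (hN : β ≤ N) (hC₁ : 0 ≤ C₁) (h₀ : x ≤ C₀)
    (h₁ : r ^ N * x ≤ C₁ * t ^ N) :
    x ≤ 2 ^ N * (C₀ + C₁) * t ^ β * (1 + r) ^ (-β) := by
  have hr' : 0 < 1 + r := by linarith
  have htN : (1 : ℝ) ≤ t ^ N := one_le_pow₀ ht
  have hC₀ : 0 ≤ C₀ := hx.trans h₀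
  have h2 : (1 : ℝ) ≤ 2 ^ N := one_le_pow₀ one_le_two
  set s := t / (1 + r) with hs
  have hs0 : 0 < s := by positivity
  rw [mul_assoc, Real.rpow_neg hr'.le, ← div_eq_mul_inv, ← Real.div_rpow (by linarith) hr'.le, ← hs]
  rcases le_total 1 s with h | h
  · calc x ≤ C₀ + C₁ := by linarith
      _ ≤ 2 ^ N * (C₀ + C₁) := le_mul_of_one_le_left (by positivity) h2
      _ ≤ _ := le_mul_of_one_le_right (by positivity) (Real.one_le_rpow h hβ)
  · have h3 : (1 + r) ^ N ≤ 2 ^ N * (1 + r ^ N) := by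
      rcases le_total r 1 with h | h
      · calc (1 + r) ^ N ≤ 2 ^ N := by gcongr; linarith
          _ ≤ _ := le_mul_of_one_le_right (by positivity) (by linarith [pow_nonneg hr N])
      · calc (1 + r) ^ N ≤ (2 * r) ^ N := by gcongr; linarith
          _ = 2 ^ N * r ^ N := mul_pow _ _ _
          _ ≤ _ := by gcongr; linarith
    calc x ≤ 2 ^ N * (C₀ + C₁) * s ^ N := by
          rw [hs, div_pow, ← mul_div_assoc, le_div_iff₀ (by positivity)]
          calc x * (1 + r) ^ N ≤ x * (2 ^ N * (1 + r ^ N)) := by gcongr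
            _ = 2 ^ N * (x + r ^ N * x) := by ring
            _ ≤ 2 ^ N * (C₀ * t ^ N + C₁ * t ^ N) := by
              gcongr
              exact h₀.trans (le_mul_of_one_le_right hC₀ htN)
            _ = _ := by ring
      _ ≤ _ := by
        gcongr
        rw [← Real.rpow_natCast]
        exact Real.rpow_le_rpow_of_exponent_ge hs0 h hN

/-- the small-jump density is smooth and all its derivatives decay at any
polynomial rate, with constants depending on `κ` only through `κ₁^β`. -/
theorem stmt_16 (d : ℕ) (hd : 1 ≤ d) (α : ℝ) (hα : α ∈ Set.Ioo (0 : ℝ) 2)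
    (j : ℕ) (β : ℝ) (hβ : 0 ≤ β) :
    ∃ C > (0 : ℝ), ∀ (κ : EuclideanSpace ℝ (Fin d) → ℝ) (κ₁ : ℝ), 1 ≤ κ₁ →
      Measurable κ → (∀ y, 1 ≤ κ y ∧ κ y ≤ κ₁) → (∀ y, κ (-y) = κ y) →
      ContDiff ℝ (⊤ : ℕ∞) (qK d α κ) ∧
      ∀ z : EuclideanSpace ℝ (Fin d) × EuclideanSpace ℝ (Fin d),
        ‖iteratedFDeriv ℝ j (qK d α κ) z‖ ≤
          C * κ₁ ^ β * (1 + Real.sqrt (‖z.1‖ ^ 2 + ‖z.2‖ ^ 2)) ^ (-β) := by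
  choose K hK0 hK using exists_integral_norm_pow_mul_norm_iteratedFDeriv_exp_neg_phiK_le
    (d := d) (α := α) hd hα
  set B : ℕ → ℝ := fun n => (2 * π) ^ n * (2 * π * ‖prodInnerSL (EuclideanSpace ℝ (Fin d))‖) ^ j *
    (2 * j + 2) ^ n * ∑ p ∈ Finset.range (j + 1) ×ˢ Finset.range (n + 1), K p.1 p.2 with hB
  have hB0 (n : ℕ) : 0 ≤ B n :=
    mul_nonneg (by positivity) (Finset.sum_nonneg fun p _ => hK0 p.1 p.2)
  set c : ℝ := (2 * π) ^ (-(2 * (d : ℝ))) with hc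
  have hc0 : 0 < c := by positivity
  set N := ⌈β⌉₊ with hN
  refine ⟨c * (2 ^ N * (B 0 + B N)) + 1, by have := hB0 0; have := hB0 N; positivity,
    fun κ κ₁ hκ₁ hκm hκ _ => ?_⟩
  obtain ⟨A, -, hA⟩ := exists_norm_iteratedFDeriv_phiK_le (d := d) hd hα.2
  obtain ⟨hsmooth, hdecay⟩ := contDiff_integral_cos_mul (f := fun w => Real.exp (-phiK d α κ w))
    (hA κ κ₁ hκm hκ).1.neg.exp fun k n => (hK k n κ κ₁ hκ₁ hκm hκ).1
  have hq : qK d α κ = c • fun z => ∫ w : EuclideanSpace ℝ (Fin d) × EuclideanSpace ℝ (Fin d),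
      Real.cos (⟪w.1, z.1⟫ + ⟪w.2, z.2⟫) * Real.exp (-phiK d α κ w) := rfl
  rw [hq]
  refine ⟨contDiff_const.smul hsmooth, fun z => ?_⟩
  rw [iteratedFDeriv_const_smul_apply (hsmooth.contDiffAt.of_le (mod_cast le_top)), norm_smul,
    Real.norm_of_nonneg hc0.le]
  have hdecay' (n : ℕ) := calc
    _ ≤ _ := hdecay j n z
    _ ≤ (2 * π) ^ n * (2 * π * ‖prodInnerSL (EuclideanSpace ℝ (Fin d))‖) ^ j *
        (2 * j + 2) ^ n * ∑ p ∈ Finset.range (j + 1) ×ˢ Finset.range (n + 1),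
          K p.1 p.2 * κ₁ ^ n := by
      refine mul_le_mul_of_nonneg_left (Finset.sum_le_sum fun p hp => ?_) (by positivity)
      refine (hK p.1 p.2 κ κ₁ hκ₁ hκm hκ).2.trans ?_
      rw [Finset.mem_product, Finset.mem_range, Finset.mem_range] at hp
      exact mul_le_mul_of_nonneg_left (pow_le_pow_right₀ hκ₁ (by lia)) (hK0 _ _)
    _ = B n * κ₁ ^ n := by rw [← Finset.sum_mul, hB, mul_assoc _ _ (κ₁ ^ n)]
  have hfin := le_mul_rpow_mul_one_add_rpow_neg (norm_nonneg _) (Real.sqrt_nonneg _) hκ₁ hβ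
    (Nat.le_ceil β) (hB0 N) (by simpa only [pow_zero, one_mul, mul_one] using hdecay' 0)
    (hdecay' N)
  calc _ ≤ c * (2 ^ N * (B 0 + B N) * κ₁ ^ β * (1 + √(‖z.1‖ ^ 2 + ‖z.2‖ ^ 2)) ^ (-β)) := by
        gcongr
    _ = c * (2 ^ N * (B 0 + B N)) * κ₁ ^ β * (1 + √(‖z.1‖ ^ 2 + ‖z.2‖ ^ 2)) ^ (-β) := by ring
    _ ≤ _ := by
        gcongr
        linarith
end

section
/- Let d ≥ 1, α ∈ (0,2), κ₁ ≥ 1, and let κ : ℝ^d → ℝ be measurable with 1 ≤ κ(y) ≤ κ₁ for all y and κ(−y) = κ(y). Set ĉ := ∫_{1/3 < |y| ≤ 1} |y|^{−d−α} dy. Then there exists a constant C₁ = C₁(d,α) > 0 (independent of κ and κ₁) such that q(x,v) ≥ C₁ · e^{−ĉ κ₁} for all (x,v) ∈ ℝ^d × ℝ^d with |x| ≤ 1 and |v| ≤ 1. -/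
open MeasureTheory Real RealInnerProductSpace

namespace KineticDensity

open Filter Topology

/-- The phase space of positions and velocities. -/
abbrev Phase (d : ℕ) := EuclideanSpace ℝ (Fin d) × EuclideanSpace ℝ (Fin d)

/-- The Euclidean inner product on phase space. -/
noncomputable def pairing {d : ℕ} (w z : Phase d) : ℝ := ⟪w.1, z.1⟫ + ⟪w.2, z.2⟫

/-- The cosine transform `z ↦ ∫ cos (w · z) H(w) dw`. -/
noncomputable def cosTransform {d : ℕ} (H : Phase d → ℝ) (z : Phase d) : ℝ :=
  ∫ w, cos (pairing w z) * H w

/-- Bounded multipliers which preserve nonnegativity of the cosine transform. -/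
structure IsPosMultiplier {d : ℕ} (g : Phase d → ℝ) : Prop where
  measurable : Measurable g
  bounded : ∃ C, ∀ w, |g w| ≤ C
  nonneg : ∀ H, Integrable H → (∀ z, 0 ≤ cosTransform H z) →
    ∀ z, 0 ≤ cosTransform (fun w => H w * g w) z

section Multiplier

variable {d : ℕ}

@[fun_prop]
lemma continuous_pairing : Continuous (fun p : Phase d × Phase d => pairing p.1 p.2) := by
  unfold pairing; fun_prop

@[fun_prop]
lemma Continuous.pairing {X : Type*} [TopologicalSpace X] {f g : X → Phase d}
    (hf : Continuous f) (hg : Continuous g) : Continuous fun x => pairing (f x) (g x) :=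
  continuous_pairing.comp (hf.prodMk hg)

@[fun_prop]
lemma Measurable.pairing {X : Type*} [MeasurableSpace X] {f g : X → Phase d}
    (hf : Measurable f) (hg : Measurable g) : Measurable fun x => pairing (f x) (g x) :=
  continuous_pairing.measurable.comp (hf.prodMk hg)

lemma pairing_add (w z a : Phase d) : pairing w (z + a) = pairing w z + pairing w a := by
  simp [pairing, inner_add_right]; ring

lemma pairing_sub (w z a : Phase d) : pairing w (z - a) = pairing w z - pairing w a := by
  simp [pairing, inner_sub_right]; ring

lemma abs_pairing_le (w z : Phase d) : |pairing w z| ≤ 2 * ‖w‖ * ‖z‖ := by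
  have h1 := abs_real_inner_le_norm w.1 z.1
  have h2 := abs_real_inner_le_norm w.2 z.2
  have h3 : ‖w.1‖ * ‖z.1‖ ≤ ‖w‖ * ‖z‖ := by gcongr <;> apply norm_fst_le
  have h4 : ‖w.2‖ * ‖z.2‖ ≤ ‖w‖ * ‖z‖ := by gcongr <;> apply norm_snd_le
  have := abs_add_le ⟪w.1, z.1⟫ ⟪w.2, z.2⟫
  unfold pairing
  linarith

lemma integrable_cos_mul {H : Phase d → ℝ} (hH : Integrable H) (z : Phase d) :
    Integrable fun w => cos (pairing w z) * H w :=
  hH.bdd_mul (c := 1) (by fun_prop) (.of_forall fun w => abs_cos_le_one _)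

lemma continuous_cosTransform {H : Phase d → ℝ} (hH : Integrable H) :
    Continuous (cosTransform H) := by
  refine continuous_of_dominated (bound := fun w => ‖H w‖)
    (fun z => (integrable_cos_mul hH z).aestronglyMeasurable) (fun z => .of_forall fun w => ?_)
    hH.norm (.of_forall fun w => by fun_prop)
  rw [norm_mul]
  exact mul_le_of_le_one_left (norm_nonneg _) (abs_cos_le_one _)

lemma cosTransform_add {H₁ H₂ : Phase d → ℝ} (h₁ : Integrable H₁) (h₂ : Integrable H₂)
    (z : Phase d) :
    cosTransform (fun w => H₁ w + H₂ w) z = cosTransform H₁ z + cosTransform H₂ z := by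
  simp only [cosTransform, mul_add]
  exact integral_add (integrable_cos_mul h₁ z) (integrable_cos_mul h₂ z)

lemma cosTransform_sub {H₁ H₂ : Phase d → ℝ} (h₁ : Integrable H₁) (h₂ : Integrable H₂)
    (z : Phase d) :
    cosTransform (fun w => H₁ w - H₂ w) z = cosTransform H₁ z - cosTransform H₂ z := by
  simp only [cosTransform, mul_sub]
  exact integral_sub (integrable_cos_mul h₁ z) (integrable_cos_mul h₂ z)

lemma cosTransform_mul_const (H : Phase d → ℝ) (c : ℝ) (z : Phase d) :
    cosTransform (fun w => H w * c) z = cosTransform H z * c := by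
  simp only [cosTransform, ← mul_assoc]
  exact integral_mul_const c _

/-- Modulation by a cosine becomes averaging of two translates. -/
lemma cosTransform_mul_cos {H : Phase d → ℝ} (hH : Integrable H) (a z : Phase d) :
    cosTransform (fun w => H w * cos (pairing w a)) z =
      (cosTransform H (z + a) + cosTransform H (z - a)) / 2 := by
  simp only [cosTransform]
  rw [← integral_add (integrable_cos_mul hH _) (integrable_cos_mul hH _), ← integral_div]
  congr 1 with w
  rw [pairing_add, pairing_sub, cos_add, cos_sub]
  ring

namespace IsPosMultiplier

variable {g g₁ g₂ : Phase d → ℝ}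

lemma integrable_mul (hg : IsPosMultiplier g) {H : Phase d → ℝ} (hH : Integrable H) :
    Integrable fun w => H w * g w := by
  obtain ⟨C, hC⟩ := hg.bounded
  exact hH.mul_bdd (c := C) hg.measurable.aestronglyMeasurable (.of_forall hC)

lemma const {c : ℝ} (hc : 0 ≤ c) : IsPosMultiplier fun _ : Phase d => c where
  measurable := measurable_const
  bounded := ⟨|c|, fun _ => le_rfl⟩
  nonneg H _ hpos z := by
    rw [cosTransform_mul_const]
    exact mul_nonneg (hpos z) hc

lemma mul (h₁ : IsPosMultiplier g₁) (h₂ : IsPosMultiplier g₂) :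
    IsPosMultiplier fun w => g₁ w * g₂ w where
  measurable := h₁.measurable.mul h₂.measurable
  bounded := by
    obtain ⟨C₁, hC₁⟩ := h₁.bounded
    obtain ⟨C₂, hC₂⟩ := h₂.bounded
    exact ⟨C₁ * C₂, fun w => by
      rw [abs_mul]
      exact mul_le_mul (hC₁ w) (hC₂ w) (abs_nonneg _) ((abs_nonneg _).trans (hC₁ w))⟩
  nonneg H hH hpos z := by
    simp only [← mul_assoc]
    exact h₂.nonneg _ (h₁.integrable_mul hH) (h₁.nonneg H hH hpos) z

lemma add (h₁ : IsPosMultiplier g₁) (h₂ : IsPosMultiplier g₂) :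
    IsPosMultiplier fun w => g₁ w + g₂ w where
  measurable := h₁.measurable.add h₂.measurable
  bounded := by
    obtain ⟨C₁, hC₁⟩ := h₁.bounded
    obtain ⟨C₂, hC₂⟩ := h₂.bounded
    exact ⟨C₁ + C₂, fun w => (abs_add_le _ _).trans (add_le_add (hC₁ w) (hC₂ w))⟩
  nonneg H hH hpos z := by
    simp only [mul_add]
    rw [cosTransform_add (h₁.integrable_mul hH) (h₂.integrable_mul hH)]
    exact add_nonneg (h₁.nonneg H hH hpos z) (h₂.nonneg H hH hpos z)

lemma pow (hg : IsPosMultiplier g) (n : ℕ) : IsPosMultiplier fun w => g w ^ n := by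
  induction n with
  | zero => simpa using const zero_le_one
  | succ n ih => simpa only [pow_succ] using ih.mul hg

lemma sum {ι : Type*} (s : Finset ι) {f : ι → Phase d → ℝ}
    (hf : ∀ i, IsPosMultiplier (f i)) : IsPosMultiplier fun w => ∑ i ∈ s, f i w := by
  classical
  induction s using Finset.induction_on with
  | empty => simpa using const le_rfl
  | insert i s hi ih => simpa only [Finset.sum_insert hi] using (hf i).add ih

/-- Bounded pointwise limits of positive multipliers are positive multipliers. -/
lemma of_tendsto {f : ℕ → Phase d → ℝ} (hf : ∀ᶠ n in atTop, IsPosMultiplier (f n)) {C : ℝ}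
    (hC : ∀ n w, |f n w| ≤ C) (hg : Measurable g)
    (hlim : ∀ w, Tendsto (fun n => f n w) atTop (𝓝 (g w))) : IsPosMultiplier g where
  measurable := hg
  bounded := ⟨C, fun w => le_of_tendsto (hlim w).abs (.of_forall fun n => hC n w)⟩
  nonneg H hH hpos z := by
    obtain ⟨N, hN⟩ := eventually_atTop.1 hf
    refine ge_of_tendsto' (x := atTop)
      (f := fun n => cosTransform (fun w => H w * f (n + N) w) z) ?_
      fun n => (hN _ (Nat.le_add_left N n)).nonneg H hH hpos z
    refine tendsto_integral_of_dominated_convergence (fun w => ‖H w‖ * C)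
      (fun n => (integrable_cos_mul ((hN _ (Nat.le_add_left N n)).integrable_mul hH)
        z).aestronglyMeasurable)
      (hH.norm.mul_const C) (fun n => .of_forall fun w => ?_) (.of_forall fun w => ?_)
    · rw [norm_mul, norm_mul]
      calc |cos (pairing w z)| * (‖H w‖ * |f (n + N) w|) ≤ 1 * (‖H w‖ * C) := by
            gcongr
            · exact abs_cos_le_one _
            · exact hC _ _
        _ = _ := one_mul _
    · exact (((hlim w).comp (tendsto_add_atTop_nat N)).const_mul _).const_mul _

lemma hasSum_exp (x : ℝ) : HasSum (fun n : ℕ => x ^ n / n.factorial) (exp x) := by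
  rw [Real.exp_eq_exp_ℝ]
  exact NormedSpace.expSeries_div_hasSum_exp x

/-- The exponential series of a positive multiplier dominates each of its terms. -/
lemma exp_sub_pow (hg : IsPosMultiplier g) (k : ℕ) :
    IsPosMultiplier fun w => exp (g w) - g w ^ k / k.factorial := by
  obtain ⟨C, hC⟩ := hg.bounded
  have hterm : ∀ n : ℕ, IsPosMultiplier fun w => g w ^ n / n.factorial := fun n => by
    simp only [div_eq_mul_inv]
    exact (hg.pow n).mul (const (by positivity))
  refine of_tendsto
    (f := fun n w => ∑ i ∈ (Finset.range n).erase k, g w ^ i / i.factorial) (C := exp C)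
    (.of_forall fun n => sum _ hterm) (fun n w => ?_) ?_ fun w => ?_
  · have hC0 : 0 ≤ C := (abs_nonneg _).trans (hC w)
    calc |∑ i ∈ (Finset.range n).erase k, g w ^ i / i.factorial|
        ≤ ∑ i ∈ (Finset.range n).erase k, |g w ^ i / i.factorial| :=
          Finset.abs_sum_le_sum_abs _ _
      _ ≤ ∑ i ∈ (Finset.range n).erase k, C ^ i / i.factorial := by
          gcongr with i
          rw [abs_div, abs_pow, Nat.abs_cast]
          gcongr
          exact hC w
      _ ≤ exp C := sum_le_hasSum _ (fun i _ => by positivity) (hasSum_exp C)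
  · exact hg.measurable.exp.sub ((hg.measurable.pow_const k).div_const _)
  · refine ((hasSum_exp (g w)).tendsto_sum_nat.sub_const _).congr' ?_
    filter_upwards [eventually_gt_atTop k] with n hn
    rw [← Finset.sum_erase_eq_sub (Finset.mem_range.2 hn)]

lemma exp (hg : IsPosMultiplier g) : IsPosMultiplier fun w => exp (g w) := by
  simpa using (hg.exp_sub_pow 0).add (const zero_le_one)

end IsPosMultiplier

end Multiplier

section Jumps

variable {d : ℕ} {Ω : Type*} [MeasurableSpace Ω]

/-- The cosine integral of the jump intensity `ρ μ` with jumps `a`. -/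
noncomputable def jumpCos (μ : Measure Ω) (a : Ω → Phase d) (ρ : Ω → ℝ) (w : Phase d) : ℝ :=
  ∫ ω, cos (pairing w (a ω)) * ρ ω ∂μ

/-- The Lévy exponent of the jump intensity `ρ μ` with jumps `a`. -/
noncomputable def levyExp (μ : Measure Ω) (a : Ω → Phase d) (ρ : Ω → ℝ) (w : Phase d) : ℝ :=
  ∫ ω, (1 - cos (pairing w (a ω))) * ρ ω ∂μ

variable {μ : Measure Ω} {a : Ω → Phase d} {ρ ρ₁ ρ₂ : Ω → ℝ}

lemma integrable_jumpCos (ha : Measurable a) (hρ : Integrable ρ μ) (w : Phase d) :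
    Integrable (fun ω => cos (pairing w (a ω)) * ρ ω) μ :=
  hρ.bdd_mul (c := 1) (by fun_prop) (.of_forall fun ω => abs_cos_le_one _)

lemma abs_jumpCos_le (ha : Measurable a) (hρ : Integrable ρ μ) (w : Phase d) :
    |jumpCos μ a ρ w| ≤ ∫ ω, ‖ρ ω‖ ∂μ := by
  refine (norm_integral_le_integral_norm _).trans
    (integral_mono (integrable_jumpCos ha hρ w).norm hρ.norm fun ω => ?_)
  rw [norm_mul]
  exact mul_le_of_le_one_left (norm_nonneg _) (abs_cos_le_one _)

lemma measurable_jumpCos [SFinite μ] (ha : Measurable a) (hρ : Measurable ρ) :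
    Measurable (jumpCos μ a ρ) := by
  refine (StronglyMeasurable.integral_prod_right (f := fun w ω => cos (pairing w (a ω)) * ρ ω)
    (Measurable.stronglyMeasurable ?_)).measurable
  unfold Function.uncurry
  fun_prop

lemma measurable_levyExp [SFinite μ] (ha : Measurable a) (hρ : Measurable ρ) :
    Measurable (levyExp μ a ρ) := by
  refine (StronglyMeasurable.integral_prod_right
    (f := fun w ω => (1 - cos (pairing w (a ω))) * ρ ω)
    (Measurable.stronglyMeasurable ?_)).measurable
  unfold Function.uncurry
  fun_prop

lemma levyExp_nonneg (hρ : 0 ≤ᵐ[μ] ρ) (w : Phase d) : 0 ≤ levyExp μ a ρ w :=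
  integral_nonneg_of_ae (hρ.mono fun _ h => mul_nonneg (sub_nonneg.2 (cos_le_one _)) h)

lemma levyExp_eq_sub_jumpCos (ha : Measurable a) (hρ : Integrable ρ μ) (w : Phase d) :
    levyExp μ a ρ w = ∫ ω, ρ ω ∂μ - jumpCos μ a ρ w := by
  simp only [levyExp, jumpCos, sub_mul, one_mul]
  exact integral_sub hρ (integrable_jumpCos ha hρ w)

lemma levyExp_add (w : Phase d)
    (h₁ : Integrable (fun ω => (1 - cos (pairing w (a ω))) * ρ₁ ω) μ)
    (h₂ : Integrable (fun ω => (1 - cos (pairing w (a ω))) * ρ₂ ω) μ) :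
    levyExp μ a (fun ω => ρ₁ ω + ρ₂ ω) w = levyExp μ a ρ₁ w + levyExp μ a ρ₂ w := by
  simp only [levyExp, mul_add]
  exact integral_add h₁ h₂

lemma cosTransform_mul_jumpCos [SFinite μ] (ha : Measurable a) (hρ : Integrable ρ μ)
    {H : Phase d → ℝ} (hH : Integrable H) (z : Phase d) :
    cosTransform (fun w => H w * jumpCos μ a ρ w) z =
      ∫ ω, (cosTransform H (z + a ω) + cosTransform H (z - a ω)) / 2 * ρ ω ∂μ := by
  have hint : Integrable (Function.uncurry fun w ω =>
      cos (pairing w z) * (H w * cos (pairing w (a ω))) * ρ ω) (volume.prod μ) := by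
    have : Integrable (fun p : Phase d × Ω =>
        (cos (pairing p.1 z) * cos (pairing p.1 (a p.2))) * (H p.1 * ρ p.2))
        (volume.prod μ) := by
      refine (hH.mul_prod hρ).bdd_mul (c := 1) ?_ (.of_forall fun p => ?_)
      · exact (by fun_prop : Measurable _).aestronglyMeasurable
      · rw [norm_mul]
        exact mul_le_one₀ (abs_cos_le_one _) (norm_nonneg _) (abs_cos_le_one _)
    refine this.congr (.of_forall fun p => ?_)
    simp only [Function.uncurry]
    ring
  calc cosTransform (fun w => H w * jumpCos μ a ρ w) z
      = ∫ w, ∫ ω, cos (pairing w z) * (H w * cos (pairing w (a ω))) * ρ ω ∂μ := by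
        simp only [cosTransform, jumpCos]
        congr 1 with w
        rw [← integral_const_mul, ← integral_const_mul]
        congr 1 with ω
        ring
    _ = ∫ ω, (∫ w, cos (pairing w z) * (H w * cos (pairing w (a ω))) * ρ ω) ∂μ :=
        integral_integral_swap hint
    _ = _ := by
        congr 1 with ω
        rw [integral_mul_const, ← cosTransform_mul_cos hH]
        rfl

lemma isPosMultiplier_jumpCos [SFinite μ] (ha : Measurable a) (hm : Measurable ρ)
    (hρ : Integrable ρ μ) (hpos : 0 ≤ᵐ[μ] ρ) : IsPosMultiplier (jumpCos μ a ρ) where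
  measurable := measurable_jumpCos ha hm
  bounded := ⟨_, abs_jumpCos_le ha hρ⟩
  nonneg H hH hH0 z := by
    rw [cosTransform_mul_jumpCos ha hρ hH]
    refine integral_nonneg_of_ae (hpos.mono fun ω h => mul_nonneg ?_ h)
    have h₁ := hH0 (z + a ω)
    have h₂ := hH0 (z - a ω)
    positivity

/-- The characteristic function of an infinitely divisible law is a positive multiplier. -/
lemma isPosMultiplier_exp_neg_levyExp [IsFiniteMeasure μ] (ha : Measurable a)
    (hm : Measurable ρ) (hpos : 0 ≤ᵐ[μ] ρ)
    (hint : ∀ w, Integrable (fun ω => (1 - cos (pairing w (a ω))) * ρ ω) μ) :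
    IsPosMultiplier fun w => exp (-levyExp μ a ρ w) := by
  set τ : ℕ → Ω → ℝ := fun n ω => min (ρ ω) n
  have hτm : ∀ n, Measurable (τ n) := fun n => hm.min measurable_const
  have hτpos : ∀ n, 0 ≤ᵐ[μ] τ n := fun n =>
    hpos.mono fun ω h => le_min h (Nat.cast_nonneg n)
  have hτint : ∀ n, Integrable (τ n) μ := fun n =>
    Integrable.of_bound (hτm n).aestronglyMeasurable n ((hτpos n).mono fun ω h => by
      rw [Real.norm_of_nonneg h]
      exact min_le_right _ _)
  refine IsPosMultiplier.of_tendsto (f := fun n w => exp (-levyExp μ a (τ n) w)) (C := 1)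
    (.of_forall fun n => ?_) (fun n w => ?_) (measurable_levyExp ha hm).neg.exp fun w => ?_
  · have h := ((isPosMultiplier_jumpCos ha (hτm n) (hτint n) (hτpos n)).exp).mul
      (.const (exp_pos (-∫ ω, τ n ω ∂μ)).le)
    convert h using 2 with w
    rw [← exp_add, levyExp_eq_sub_jumpCos ha (hτint n)]
    ring_nf
  · rw [abs_of_pos (exp_pos _)]
    exact exp_le_one_iff.2 (neg_nonpos.2 (levyExp_nonneg (hτpos n) w))
  · refine (continuous_exp.tendsto _).comp (Tendsto.neg ?_)
    refine tendsto_integral_of_dominated_convergence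
      (fun ω => (1 - cos (pairing w (a ω))) * ρ ω) (fun n => ?_) (hint w)
      (fun n => ?_) (.of_forall fun ω => ?_)
    · have := hτm n
      exact (by fun_prop : Measurable _).aestronglyMeasurable
    · filter_upwards [hτpos n] with ω h
      have hc : 0 ≤ 1 - cos (pairing w (a ω)) := sub_nonneg.2 (cos_le_one _)
      rw [Real.norm_of_nonneg (mul_nonneg hc h)]
      exact mul_le_mul_of_nonneg_left (min_le_left _ _) hc
    · refine Tendsto.const_mul _ (tendsto_const_nhds.congr' ?_)
      obtain ⟨N, hN⟩ := exists_nat_ge (ρ ω)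
      filter_upwards [eventually_ge_atTop N] with n hn
      exact (min_eq_left (hN.trans (by exact_mod_cast hn))).symm

end Jumps

section KineticJumps

variable {d : ℕ}

/-- Jump times in `(0, 1]` and jump sizes in the closed unit ball. -/
noncomputable def jumpMeasure (d : ℕ) : Measure (ℝ × EuclideanSpace ℝ (Fin d)) :=
  (volume.restrict (Set.Ioc (0 : ℝ) 1)).prod (volume.restrict {y | ‖y‖ ≤ 1})

/-- A jump of size `y` with remaining time `s` moves the phase point by `(s y, y)`. -/
def jump (p : ℝ × EuclideanSpace ℝ (Fin d)) : Phase d := (p.1 • p.2, p.2)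

@[fun_prop]
lemma continuous_jump : Continuous (jump (d := d)) := by
  unfold jump; fun_prop

@[fun_prop]
lemma measurable_jump : Measurable (jump (d := d)) := continuous_jump.measurable

lemma setOf_norm_le_one :
    {y : EuclideanSpace ℝ (Fin d) | ‖y‖ ≤ 1} = Metric.closedBall 0 1 := by
  ext y; simp

instance isFiniteMeasure_unitBall :
    IsFiniteMeasure (volume.restrict {y : EuclideanSpace ℝ (Fin d) | ‖y‖ ≤ 1}) := by
  rw [setOf_norm_le_one]
  exact ⟨by simpa using measure_closedBall_lt_top⟩

instance : IsFiniteMeasure (jumpMeasure d) := by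
  unfold jumpMeasure; infer_instance

lemma jumpMeasure_eq_restrict :
    jumpMeasure d = volume.restrict (Set.Ioc (0 : ℝ) 1 ×ˢ {y | ‖y‖ ≤ 1}) := by
  rw [jumpMeasure, Measure.prod_restrict]; rfl

lemma ae_jumpMeasure : ∀ᵐ p ∂jumpMeasure d, p.1 ∈ Set.Ioc (0 : ℝ) 1 ∧ ‖p.2‖ ≤ 1 := by
  rw [jumpMeasure_eq_restrict]
  refine (ae_restrict_mem (measurableSet_Ioc.prod ?_)).mono fun p hp => hp
  exact measurableSet_le measurable_norm measurable_const

lemma pairing_jump (w : Phase d) (p : ℝ × EuclideanSpace ℝ (Fin d)) :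
    pairing w (jump p) = ⟪p.1 • w.1 + w.2, p.2⟫ := by
  simp [pairing, jump, inner_add_left, real_inner_smul_left, real_inner_smul_right]

lemma norm_jump_le {p : ℝ × EuclideanSpace ℝ (Fin d)} (hp : p.1 ∈ Set.Ioc (0 : ℝ) 1) :
    ‖jump p‖ ≤ ‖p.2‖ := by
  refine max_le ?_ le_rfl
  simp only [jump, norm_smul, Real.norm_of_nonneg hp.1.le]
  exact mul_le_of_le_one_left (norm_nonneg _) hp.2

/-- The stable weight `|y|^{-d-α}`. -/
noncomputable def stableWeight (d : ℕ) (α : ℝ) (y : EuclideanSpace ℝ (Fin d)) : ℝ :=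
  ‖y‖ ^ (-(d : ℝ) - α)

@[fun_prop]
lemma measurable_stableWeight (α : ℝ) : Measurable (stableWeight d α) := by
  unfold stableWeight; fun_prop

lemma stableWeight_nonneg (α : ℝ) (y : EuclideanSpace ℝ (Fin d)) : 0 ≤ stableWeight d α y :=
  rpow_nonneg (norm_nonneg _) _

lemma integrable_sq_norm_mul_stableWeight (hd : 1 ≤ d) {α : ℝ} (hα : α < 2) :
    IntegrableOn (fun y => ‖y‖ ^ 2 * stableWeight d α y)
      {y : EuclideanSpace ℝ (Fin d) | ‖y‖ ≤ 1} := by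
  have : Nonempty (Fin d) := ⟨⟨0, hd⟩⟩
  have hm : MeasurableSet {y : EuclideanSpace ℝ (Fin d) | ‖y‖ ≤ 1} :=
    measurableSet_le measurable_norm measurable_const
  rw [← integrable_indicator_iff hm]
  have key := (integrable_fun_norm_addHaar (volume : Measure (EuclideanSpace ℝ (Fin d)))
    (f := (Set.Iic (1 : ℝ)).indicator fun t => t ^ 2 * t ^ (-(d : ℝ) - α))).2 ?_
  · refine key.congr (.of_forall fun y => ?_)
    by_cases hy : ‖y‖ ≤ 1 <;> simp [Set.indicator, hy, stableWeight]
  · have h1 : IntegrableOn (fun t : ℝ => t ^ (1 - α)) (Set.Ioc 0 1) :=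
      (intervalIntegrable_iff_integrableOn_Ioc_of_le zero_le_one).1
        (intervalIntegral.intervalIntegrable_rpow' (by linarith))
    have h2 : IntegrableOn ((Set.Iic (1 : ℝ)).indicator fun t => t ^ (1 - α)) (Set.Ioi 0) := by
      rwa [integrableOn_indicator_iff measurableSet_Iic, Set.inter_comm, Set.Ioi_inter_Iic]
    refine h2.congr_fun (fun t ht => ?_) measurableSet_Ioi
    have ht0 : 0 < t := ht
    by_cases h : t ≤ 1
    · simp only [Set.indicator, Set.mem_Iic, h, if_true, finrank_euclideanSpace,
        Fintype.card_fin, smul_eq_mul]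
      rw [← rpow_natCast t (d - 1), ← rpow_natCast t 2, ← rpow_add ht0, ← rpow_add ht0,
        Nat.cast_sub hd]
      congr 1
      push_cast
      ring
    · simp [Set.indicator, h]

lemma integrable_jump_sq (hd : 1 ≤ d) {α : ℝ} (hα : α < 2) :
    Integrable (fun p => ‖p.2‖ ^ 2 * stableWeight d α p.2) (jumpMeasure d) :=
  (integrable_sq_norm_mul_stableWeight hd hα).comp_snd (volume.restrict (Set.Ioc (0 : ℝ) 1))

lemma one_sub_cos_jump_mul_le {α K : ℝ} {k : EuclideanSpace ℝ (Fin d) → ℝ}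
    (hk : ∀ y, |k y| ≤ K) (w : Phase d) {p : ℝ × EuclideanSpace ℝ (Fin d)}
    (hp : p.1 ∈ Set.Ioc (0 : ℝ) 1) :
    |(1 - cos (pairing w (jump p))) * (k p.2 * stableWeight d α p.2)| ≤
      2 * K * ‖w‖ ^ 2 * (‖p.2‖ ^ 2 * stableWeight d α p.2) := by
  have h0 : 0 ≤ 1 - cos (pairing w (jump p)) := sub_nonneg.2 (cos_le_one _)
  have h1 : 1 - cos (pairing w (jump p)) ≤ 2 * ‖w‖ ^ 2 * ‖p.2‖ ^ 2 := by
    have h2 : |pairing w (jump p)| ≤ 2 * ‖w‖ * ‖p.2‖ :=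
      (abs_pairing_le _ _).trans (by gcongr; exact norm_jump_le hp)
    have h3 := one_sub_sq_div_two_le_cos (x := pairing w (jump p))
    have h4 : pairing w (jump p) ^ 2 ≤ (2 * ‖w‖ * ‖p.2‖) ^ 2 := sq_le_sq' (abs_le.1 h2).1
      (abs_le.1 h2).2
    nlinarith
  rw [abs_mul, abs_mul, abs_of_nonneg h0, abs_of_nonneg (stableWeight_nonneg α p.2)]
  have hK := hk p.2
  have hs := stableWeight_nonneg α p.2
  calc (1 - cos (pairing w (jump p))) * (|k p.2| * stableWeight d α p.2)
      ≤ (2 * ‖w‖ ^ 2 * ‖p.2‖ ^ 2) * (K * stableWeight d α p.2) := by gcongr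
    _ = _ := by ring

lemma integrable_one_sub_cos_jump (hd : 1 ≤ d) {α K : ℝ} (hα : α < 2)
    {k : EuclideanSpace ℝ (Fin d) → ℝ} (hkm : Measurable k) (hk : ∀ y, |k y| ≤ K)
    (w : Phase d) :
    Integrable (fun p => (1 - cos (pairing w (jump p))) * (k p.2 * stableWeight d α p.2))
      (jumpMeasure d) := by
  refine ((integrable_jump_sq hd hα).const_mul (2 * K * ‖w‖ ^ 2)).mono' ?_ ?_
  · exact (by fun_prop : Measurable _).aestronglyMeasurable
  · filter_upwards [ae_jumpMeasure] with p hp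
    exact one_sub_cos_jump_mul_le hk w hp.1

/-- The Lévy exponent of the kinetic process whose jump density is `k(y) |y|^{-d-α}`. -/
noncomputable def kineticExp (d : ℕ) (α : ℝ) (k : EuclideanSpace ℝ (Fin d) → ℝ) :
    Phase d → ℝ :=
  levyExp (jumpMeasure d) jump fun p => k p.2 * stableWeight d α p.2

lemma kineticExp_le (hd : 1 ≤ d) {α K : ℝ} (hα : α < 2)
    {k : EuclideanSpace ℝ (Fin d) → ℝ} (hkm : Measurable k) (hk : ∀ y, |k y| ≤ K)
    (w : Phase d) :
    kineticExp d α k w ≤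
      2 * K * ‖w‖ ^ 2 * ∫ p, ‖p.2‖ ^ 2 * stableWeight d α p.2 ∂jumpMeasure d := by
  rw [← integral_const_mul]
  refine integral_mono_ae (integrable_one_sub_cos_jump hd hα hkm hk w)
    ((integrable_jump_sq hd hα).const_mul _) ?_
  filter_upwards [ae_jumpMeasure] with p hp
  exact (le_abs_self _).trans (one_sub_cos_jump_mul_le hk w hp.1)

lemma phiK_eq_kineticExp (hd : 1 ≤ d) {α K : ℝ} (hα : α < 2)
    {k : EuclideanSpace ℝ (Fin d) → ℝ} (hkm : Measurable k) (hk : ∀ y, |k y| ≤ K) :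
    phiK d α k = kineticExp d α k := by
  ext w
  have h := integrable_one_sub_cos_jump hd hα hkm hk w
  unfold jumpMeasure at h
  rw [phiK, intervalIntegral.integral_of_le zero_le_one, kineticExp, levyExp, jumpMeasure,
    integral_prod _ h]
  simp only [psiK, pairing_jump, stableWeight, mul_assoc]

end KineticJumps

section Integrability

variable {d : ℕ}

lemma psiK_one_nonneg (α : ℝ) (ζ : EuclideanSpace ℝ (Fin d)) :
    0 ≤ psiK d α (fun _ => 1) ζ :=
  integral_nonneg fun _ => mul_nonneg
    (mul_nonneg (sub_nonneg.2 (cos_le_one _)) zero_le_one) (rpow_nonneg (norm_nonneg _) _)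

lemma integrableOn_psiK_one (hd : 1 ≤ d) {α : ℝ} (hα : α < 2)
    (ζ : EuclideanSpace ℝ (Fin d)) :
    IntegrableOn (fun y => (1 - cos ⟪ζ, y⟫) * 1 * ‖y‖ ^ (-(d : ℝ) - α))
      {y : EuclideanSpace ℝ (Fin d) | ‖y‖ ≤ 1} := by
  refine ((integrable_sq_norm_mul_stableWeight hd hα).const_mul (‖ζ‖ ^ 2 / 2)).mono' ?_
    (.of_forall fun y => ?_)
  · exact (by fun_prop : Measurable _).aestronglyMeasurable
  · have h0 : 0 ≤ 1 - cos ⟪ζ, y⟫ := sub_nonneg.2 (cos_le_one _)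
    have hs := stableWeight_nonneg α y
    have h2 := sq_le_sq' (abs_le.1 (abs_real_inner_le_norm ζ y)).1
      (abs_le.1 (abs_real_inner_le_norm ζ y)).2
    have h3 := one_sub_sq_div_two_le_cos (x := ⟪ζ, y⟫)
    change ‖(1 - cos ⟪ζ, y⟫) * 1 * stableWeight d α y‖ ≤ _
    rw [mul_one, Real.norm_of_nonneg (mul_nonneg h0 hs), ← mul_assoc]
    gcongr
    linarith [mul_pow ‖ζ‖ ‖y‖ 2]

/-- The unweighted exponent grows at least like `|ζ|^α`. -/
lemma exists_psiK_one_lower_bound (hd : 1 ≤ d) {α : ℝ} (hα : α ∈ Set.Ioo (0 : ℝ) 2) :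
    ∃ c > 0, ∀ ζ, 1 ≤ ‖ζ‖ → c * ‖ζ‖ ^ α ≤ psiK d α (fun _ => 1) ζ := by
  have : Nonempty (Fin d) := ⟨⟨0, hd⟩⟩
  set V := (volume (Metric.ball (0 : EuclideanSpace ℝ (Fin d)) 1)).toReal with hV
  have hVpos : 0 < V := ENNReal.toReal_pos (Metric.measure_ball_pos _ _ one_pos).ne'
    measure_ball_lt_top.ne
  refine ⟨1 / (8 * π ^ 2) * (1 / 4) ^ d * V, by positivity, fun ζ hζ => ?_⟩
  set r := ‖ζ‖ with hr
  have hr0 : 0 < r := by linarith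
  set B := Metric.ball ((1 / (2 * r ^ 2)) • ζ) (1 / (4 * r)) with hB
  have hinner : ∀ y ∈ B, |⟪ζ, y⟫ - 1 / 2| ≤ 1 / 4 := fun y hy => by
    have h1 : ⟪ζ, y⟫ - 1 / 2 = ⟪ζ, y - (1 / (2 * r ^ 2)) • ζ⟫ := by
      rw [inner_sub_right, real_inner_smul_right, real_inner_self_eq_norm_sq, ← hr]
      field_simp
    rw [h1]
    have h2 : ‖y - (1 / (2 * r ^ 2)) • ζ‖ ≤ 1 / (4 * r) := (mem_ball_iff_norm.1 hy).le
    calc _ ≤ r * ‖y - (1 / (2 * r ^ 2)) • ζ‖ := abs_real_inner_le_norm _ _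
      _ ≤ r * (1 / (4 * r)) := by gcongr
      _ = 1 / 4 := by field_simp
  have hnorm : ∀ y ∈ B, ‖y‖ ≤ 1 / r := fun y hy => by
    have h2 : ‖y - (1 / (2 * r ^ 2)) • ζ‖ ≤ 1 / (4 * r) := (mem_ball_iff_norm.1 hy).le
    have h3 : ‖(1 / (2 * r ^ 2)) • ζ‖ = 1 / (2 * r) := by
      rw [norm_smul, Real.norm_of_nonneg (by positivity), ← hr]
      field_simp
    calc ‖y‖ = ‖(y - (1 / (2 * r ^ 2)) • ζ) + (1 / (2 * r ^ 2)) • ζ‖ := by rw [sub_add_cancel]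
      _ ≤ 1 / (4 * r) + 1 / (2 * r) := (norm_add_le _ _).trans (add_le_add h2 h3.le)
      _ ≤ 1 / r := by
        rw [show 1 / (4 * r) + 1 / (2 * r) = 3 / 4 * (1 / r) by field_simp; norm_num]
        have : 0 < 1 / r := by positivity
        linarith
  have hsub : B ⊆ {y | ‖y‖ ≤ 1} := fun y hy =>
    (hnorm y hy).trans ((div_le_one hr0).2 hζ)
  have hBm : MeasurableSet B := Metric.isOpen_ball.measurableSet
  have hlow : ∀ y ∈ B, 1 / (8 * π ^ 2) * r ^ ((d : ℝ) + α) ≤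
      (1 - cos ⟪ζ, y⟫) * 1 * ‖y‖ ^ (-(d : ℝ) - α) := fun y hy => by
    have h := abs_le.1 (hinner y hy)
    have hy0 : 0 < ‖y‖ := by
      refine norm_pos_iff.2 fun h0 => ?_
      rw [h0, inner_zero_right] at h
      linarith [h.1]
    have hcos := cos_le_one_sub_mul_cos_sq (x := ⟪ζ, y⟫)
      (abs_le.2 ⟨by linarith [pi_gt_three], by linarith [pi_gt_three]⟩)
    have h1 : 1 / (8 * π ^ 2) ≤ 1 - cos ⟪ζ, y⟫ := by
      have h2 : 1 / (8 * π ^ 2) ≤ 2 / π ^ 2 * ⟪ζ, y⟫ ^ 2 := by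
        rw [show 1 / (8 * π ^ 2) = 2 / π ^ 2 * (1 / 4) ^ 2 by field_simp; norm_num]
        gcongr
        linarith
      linarith
    have h3 : r ^ ((d : ℝ) + α) ≤ ‖y‖ ^ (-(d : ℝ) - α) := by
      rw [show -(d : ℝ) - α = -((d : ℝ) + α) by ring, rpow_neg hy0.le,
        ← inv_rpow hy0.le]
      have := hα.1
      refine rpow_le_rpow hr0.le ?_ (by positivity)
      rw [← one_div]
      exact (le_one_div hr0 hy0).2 (hnorm y hy)
    rw [mul_one]
    gcongr
    exact (by positivity : (0 : ℝ) ≤ 1 / (8 * π ^ 2)).trans h1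
  have hint := integrableOn_psiK_one hd hα.2 ζ
  calc 1 / (8 * π ^ 2) * (1 / 4) ^ d * V * r ^ α
      = ∫ y in B, 1 / (8 * π ^ 2) * r ^ ((d : ℝ) + α) := by
        rw [setIntegral_const, smul_eq_mul, Measure.real, hB,
          Measure.addHaar_ball _ _ (by positivity), ENNReal.toReal_mul,
          ENNReal.toReal_ofReal (by positivity), ← hV, finrank_euclideanSpace,
          Fintype.card_fin, rpow_add hr0, rpow_natCast,
          show 1 / (4 * r) = 1 / 4 * r⁻¹ by field_simp, mul_pow, inv_pow]
        field_simp
    _ ≤ ∫ y in B, (1 - cos ⟪ζ, y⟫) * 1 * ‖y‖ ^ (-(d : ℝ) - α) :=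
        setIntegral_mono_on (integrableOn_const (by rw [hB]; exact measure_ball_lt_top.ne))
          (hint.mono_set hsub) hBm hlow
    _ ≤ psiK d α (fun _ => 1) ζ :=
        setIntegral_mono_set hint (.of_forall fun y => mul_nonneg
          (mul_nonneg (sub_nonneg.2 (cos_le_one _)) zero_le_one)
          (rpow_nonneg (norm_nonneg _) _)) hsub.eventuallyLE

lemma norm_le_max_of_shift (w : Phase d) {s : ℝ} (hs : s ∈ Set.Icc (0 : ℝ) (1 / 2)) :
    ‖w‖ / 4 ≤ max ‖s • w.1 + w.2‖ ‖(s + 1 / 2) • w.1 + w.2‖ := by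
  set a := s • w.1 + w.2 with ha
  set b := (s + 1 / 2) • w.1 + w.2 with hb
  have h1 : w.1 = (2 : ℝ) • (b - a) := by rw [ha, hb]; module
  have h2 : w.2 = (2 * s + 1) • a - (2 * s) • b := by rw [ha, hb]; module
  have hma := le_max_left ‖a‖ ‖b‖
  have hmb := le_max_right ‖a‖ ‖b‖
  have h3 : ‖w.1‖ ≤ 4 * max ‖a‖ ‖b‖ := by
    rw [h1, norm_smul, Real.norm_of_nonneg zero_le_two]
    linarith [norm_sub_le b a]
  have h4 : ‖w.2‖ ≤ 4 * max ‖a‖ ‖b‖ := by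
    have h := norm_sub_le ((2 * s + 1) • a) ((2 * s) • b)
    rw [norm_smul, norm_smul, Real.norm_of_nonneg (by linarith [hs.1]),
      Real.norm_of_nonneg (by linarith [hs.1])] at h
    rw [h2]
    nlinarith [hs.1, hs.2, norm_nonneg a, norm_nonneg b]
  have : ‖w‖ ≤ 4 * max ‖a‖ ‖b‖ := max_le h3 h4
  linarith

lemma exists_kineticExp_one_lower_bound (hd : 1 ≤ d) {α : ℝ} (hα : α ∈ Set.Ioo (0 : ℝ) 2) :
    ∃ b > 0, ∃ C, ∀ w, b * ‖w‖ ^ α - C ≤ kineticExp d α (fun _ => 1) w := by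
  obtain ⟨c, hc, hlow⟩ := exists_psiK_one_lower_bound hd hα
  have hlow' : ∀ ζ : EuclideanSpace ℝ (Fin d), c * ‖ζ‖ ^ α - c ≤ psiK d α (fun _ => 1) ζ :=
    fun ζ => by
      rcases le_total 1 ‖ζ‖ with h | h
      · linarith [hlow ζ h]
      · have h1 := rpow_le_one (norm_nonneg ζ) h hα.1.le
        nlinarith [psiK_one_nonneg α ζ]
  refine ⟨c / 2 * (1 / 4) ^ α, by positivity, c / 2, fun w => ?_⟩
  rw [← phiK_eq_kineticExp (K := 1) hd hα.2 measurable_const (by simp), phiK]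
  set f : ℝ → ℝ := fun s => psiK d α (fun _ => 1) (s • w.1 + w.2) with hf
  have hfi : IntervalIntegrable f volume 0 1 := by
    rw [intervalIntegrable_iff_integrableOn_Ioc_of_le zero_le_one]
    have h := integrable_one_sub_cos_jump (K := 1) (k := fun _ => 1) hd hα.2
      measurable_const (by simp) w
    unfold jumpMeasure at h
    refine h.integral_prod_left.congr (.of_forall fun s => ?_)
    simp only [hf, psiK, pairing_jump, stableWeight, mul_assoc]
  have h1 : IntervalIntegrable f volume 0 (1 / 2) :=
    hfi.mono_set (by rw [Set.uIcc_of_le, Set.uIcc_of_le] <;> try norm_num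
                     exact Set.Icc_subset_Icc le_rfl (by norm_num))
  have h2 : IntervalIntegrable f volume (1 / 2) 1 :=
    hfi.mono_set (by rw [Set.uIcc_of_le, Set.uIcc_of_le] <;> try norm_num
                     exact Set.Icc_subset_Icc (by norm_num) le_rfl)
  have h3 : IntervalIntegrable (fun s => f (s + 1 / 2)) volume 0 (1 / 2) := by
    have := h2.comp_add_right (1 / 2)
    norm_num at this ⊢
    exact this
  have hsplit : ∫ s in (0 : ℝ)..1, f s = ∫ s in (0 : ℝ)..(1 / 2), (f s + f (s + 1 / 2)) := by
    rw [intervalIntegral.integral_add h1 h3, intervalIntegral.integral_comp_add_right f (1 / 2),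
      ← intervalIntegral.integral_add_adjacent_intervals h1 h2]
    norm_num
  rw [hsplit]
  have hbound : ∀ s ∈ Set.Icc (0 : ℝ) (1 / 2),
      c * (‖w‖ / 4) ^ α - c ≤ f s + f (s + 1 / 2) := fun s hs => by
    have hn1 := psiK_one_nonneg α (s • w.1 + w.2)
    have hn2 := psiK_one_nonneg α ((s + 1 / 2) • w.1 + w.2)
    rcases le_max_iff.1 (norm_le_max_of_shift w hs) with h | h
    · have := rpow_le_rpow (by positivity) h hα.1.le
      have := hlow' (s • w.1 + w.2)
      simp only [hf]
      nlinarith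
    · have := rpow_le_rpow (by positivity) h hα.1.le
      have := hlow' ((s + 1 / 2) • w.1 + w.2)
      simp only [hf]
      nlinarith
  calc c / 2 * (1 / 4) ^ α * ‖w‖ ^ α - c / 2
      = ∫ s in (0 : ℝ)..(1 / 2), (c * (‖w‖ / 4) ^ α - c) := by
        rw [intervalIntegral.integral_const, smul_eq_mul, div_eq_mul_one_div ‖w‖,
          mul_rpow (norm_nonneg _) (by norm_num)]
        ring
    _ ≤ _ := intervalIntegral.integral_mono_on (by norm_num) intervalIntegrable_const
        (h1.add h3) hbound

instance : (volume : Measure (Phase d)).IsAddHaarMeasure :=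
  inferInstanceAs ((volume.prod volume : Measure (Phase d)).IsAddHaarMeasure)

lemma integrable_exp_neg_kineticExp_one (hd : 1 ≤ d) {α : ℝ} (hα : α ∈ Set.Ioo (0 : ℝ) 2) :
    Integrable fun w => exp (-kineticExp d α (fun _ => 1) w) := by
  have : Nonempty (Fin d) := ⟨⟨0, hd⟩⟩
  obtain ⟨b, hb, C, hlow⟩ := exists_kineticExp_one_lower_bound hd hα
  have hint : Integrable fun w : Phase d => exp (-b * ‖w‖ ^ α) := by
    refine (integrable_fun_norm_addHaar (volume : Measure (Phase d))
      (f := fun t => exp (-b * t ^ α))).2 ?_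
    set n := Module.finrank ℝ (Phase d) - 1
    have hn : (-1 : ℝ) < n := by linarith [n.cast_nonneg (α := ℝ)]
    have h := integrableOn_rpow_mul_exp_neg_mul_rpow hn hα.1 hb
    simpa only [rpow_natCast, smul_eq_mul] using h
  refine (hint.const_mul (exp C)).mono' ?_ (.of_forall fun w => ?_)
  · exact (measurable_levyExp measurable_jump (by fun_prop)).neg.exp.aestronglyMeasurable
  · rw [Real.norm_of_nonneg (exp_pos _).le, ← exp_add]
    exact exp_le_exp.2 (by linarith [hlow w])

end Integrability

section Gaussian

variable {d : ℕ}

/-- The centred Gaussian `exp (-b |w|²)` on phase space. -/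
noncomputable def gauss (b : ℝ) (w : Phase d) : ℝ := exp (-b * (‖w.1‖ ^ 2 + ‖w.2‖ ^ 2))

@[fun_prop]
lemma continuous_gauss (b : ℝ) : Continuous (gauss (d := d) b) := by
  unfold gauss; fun_prop

lemma cos_mul_gauss_eq_re (b : ℝ) (w z : Phase d) :
    cos (pairing w z) * gauss b w =
      (Complex.exp (-(b : ℂ) * ‖w.1‖ ^ 2 + Complex.I * (⟪z.1, w.1⟫ : ℝ)) *
        Complex.exp (-(b : ℂ) * ‖w.2‖ ^ 2 + Complex.I * (⟪z.2, w.2⟫ : ℝ))).re := by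
  rw [← Complex.exp_add]
  have h : -(b : ℂ) * ‖w.1‖ ^ 2 + Complex.I * (⟪z.1, w.1⟫ : ℝ) +
      (-(b : ℂ) * ‖w.2‖ ^ 2 + Complex.I * (⟪z.2, w.2⟫ : ℝ)) =
      ((-b * (‖w.1‖ ^ 2 + ‖w.2‖ ^ 2) : ℝ) : ℂ) + ((pairing w z : ℝ) : ℂ) * Complex.I := by
    simp only [pairing, real_inner_comm z.1, real_inner_comm z.2]
    push_cast
    ring
  rw [h, Complex.exp_re]
  simp only [Complex.add_re, Complex.add_im, Complex.ofReal_re, Complex.ofReal_im,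
    Complex.re_ofReal_mul, Complex.im_ofReal_mul, Complex.I_re, Complex.I_im, mul_zero, mul_one,
    add_zero, zero_add]
  rw [gauss, mul_comm]

lemma integrable_gauss_prod {b : ℝ} (hb : 0 < b) (z : Phase d) :
    Integrable (fun w : Phase d =>
      Complex.exp (-(b : ℂ) * ‖w.1‖ ^ 2 + Complex.I * (⟪z.1, w.1⟫ : ℝ)) *
        Complex.exp (-(b : ℂ) * ‖w.2‖ ^ 2 + Complex.I * (⟪z.2, w.2⟫ : ℝ))) :=
  (GaussianFourier.integrable_cexp_neg_mul_sq_norm_add (b := (b : ℂ)) (by simpa)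
    Complex.I z.1).mul_prod
    (GaussianFourier.integrable_cexp_neg_mul_sq_norm_add (b := (b : ℂ)) (by simpa)
      Complex.I z.2)

lemma integrable_gauss {b : ℝ} (hb : 0 < b) : Integrable (gauss (d := d) b) := by
  refine (integrable_gauss_prod hb 0).re.congr (.of_forall fun w => ?_)
  have h := cos_mul_gauss_eq_re b w 0
  simp only [pairing, Prod.fst_zero, Prod.snd_zero, inner_zero_right, add_zero, cos_zero,
    one_mul] at h
  exact h.symm

lemma cosTransform_gauss {b : ℝ} (hb : 0 < b) (z : Phase d) :
    cosTransform (gauss b) z = (π / b) ^ d * gauss (1 / (4 * b)) z := by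
  simp only [cosTransform, cos_mul_gauss_eq_re]
  have h := integral_re (𝕜 := ℂ) (integrable_gauss_prod hb z)
  simp only [RCLike.re_eq_complex_re] at h
  rw [h, Measure.volume_eq_prod, integral_prod_mul
    (fun x : EuclideanSpace ℝ (Fin d) =>
      Complex.exp (-(b : ℂ) * ‖x‖ ^ 2 + Complex.I * (⟪z.1, x⟫ : ℝ)))
    (fun x : EuclideanSpace ℝ (Fin d) =>
      Complex.exp (-(b : ℂ) * ‖x‖ ^ 2 + Complex.I * (⟪z.2, x⟫ : ℝ))),
    GaussianFourier.integral_cexp_neg_mul_sq_norm_add (by simpa),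
    GaussianFourier.integral_cexp_neg_mul_sq_norm_add (by simpa)]
  have hπ : (π / b : ℂ) ≠ 0 := by
    exact_mod_cast (div_pos pi_pos hb).ne'
  have h2 : ∀ X Y : ℂ, (π / b : ℂ) ^ ((Module.finrank ℝ (EuclideanSpace ℝ (Fin d)) : ℂ) / 2) * X *
      ((π / b : ℂ) ^ ((Module.finrank ℝ (EuclideanSpace ℝ (Fin d)) : ℂ) / 2) * Y) =
      (((π / b) ^ d : ℝ) : ℂ) * (X * Y) := fun X Y => by
    rw [mul_mul_mul_comm, ← Complex.cpow_add _ _ hπ, add_halves, finrank_euclideanSpace,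
      Fintype.card_fin, Complex.cpow_natCast]
    push_cast
    ring
  rw [h2, ← Complex.exp_add, Complex.I_sq, gauss]
  have h3 : -1 * (‖z.1‖ : ℂ) ^ 2 / (4 * b) + -1 * (‖z.2‖ : ℂ) ^ 2 / (4 * b) =
      ((-(1 / (4 * b)) * (‖z.1‖ ^ 2 + ‖z.2‖ ^ 2) : ℝ) : ℂ) := by
    push_cast
    ring
  rw [h3, ← Complex.ofReal_exp, ← Complex.ofReal_mul, Complex.ofReal_re]

lemma gauss_pos (b : ℝ) (w : Phase d) : 0 < gauss b w := exp_pos _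

lemma cosTransform_gauss_nonneg {b : ℝ} (hb : 0 < b) (z : Phase d) :
    0 ≤ cosTransform (gauss b) z := by
  rw [cosTransform_gauss hb]
  have := gauss_pos (1 / (4 * b)) z
  positivity

/-- An integrable positive multiplier has a nonnegative cosine transform. -/
lemma IsPosMultiplier.cosTransform_nonneg {g : Phase d → ℝ} (hg : IsPosMultiplier g)
    (hgi : Integrable g) (z : Phase d) : 0 ≤ cosTransform g z := by
  set ε : ℕ → ℝ := fun n => 1 / ((n : ℝ) + 1)
  have hε : ∀ n, 0 < ε n := fun n => Nat.one_div_pos_of_nat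
  refine ge_of_tendsto' (x := atTop)
    (f := fun n => cosTransform (fun w => gauss (ε n) w * g w) z) ?_ fun n =>
      hg.nonneg _ (integrable_gauss (hε n)) (cosTransform_gauss_nonneg (hε n)) z
  refine tendsto_integral_of_dominated_convergence (fun w => ‖g w‖)
    (fun n => (integrable_cos_mul (hg.integrable_mul (integrable_gauss (hε n)))
      z).aestronglyMeasurable) hgi.norm (fun n => .of_forall fun w => ?_)
    (.of_forall fun w => ?_)
  · rw [norm_mul, norm_mul, ← mul_assoc]
    refine mul_le_of_le_one_left (norm_nonneg _)
      (mul_le_one₀ (abs_cos_le_one _) (norm_nonneg _) ?_)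
    rw [Real.norm_of_nonneg (gauss_pos _ _).le]
    exact exp_le_one_iff.2 (by have := hε n; nlinarith [sq_nonneg ‖w.1‖, sq_nonneg ‖w.2‖])
  · have h : Tendsto (fun n => gauss (ε n) w) atTop (𝓝 1) := by
      have h1 := (tendsto_one_div_add_atTop_nhds_zero_nat (𝕜 := ℝ)).neg.mul_const
        (‖w.1‖ ^ 2 + ‖w.2‖ ^ 2)
      have h2 := (continuous_exp.tendsto _).comp h1
      rw [neg_zero, zero_mul, exp_zero] at h2
      exact h2
    simpa using (h.mul_const (g w)).const_mul (cos (pairing w z))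

end Gaussian

section StrictPositivity

variable {d : ℕ}

lemma abs_cosTransform_le {H : Phase d → ℝ} (hH : Integrable H) (z : Phase d) :
    |cosTransform H z| ≤ ∫ w, ‖H w‖ := by
  refine (norm_integral_le_integral_norm _).trans
    (integral_mono (integrable_cos_mul hH z).norm hH.norm fun w => ?_)
  rw [norm_mul]
  exact mul_le_of_le_one_left (norm_nonneg _) (abs_cos_le_one _)

/-- One uniform jump propagates strict positivity of the cosine transform. -/
lemma cosTransform_mul_jumpCos_pos {H : Phase d → ℝ} (hH : Integrable H)
    (hpos : ∀ z, 0 ≤ cosTransform H z) {z : Phase d} (hz : 0 < cosTransform H z)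
    {s : ℝ} (hs : s ∈ Set.Ioo (0 : ℝ) 1) {y : EuclideanSpace ℝ (Fin d)} (hy : ‖y‖ < 1) :
    0 < cosTransform (fun w => H w * jumpCos (jumpMeasure d) jump (fun _ => 1) w)
      (z + jump (s, y)) := by
  rw [cosTransform_mul_jumpCos measurable_jump (integrable_const _) hH]
  set t := z + jump (s, y)
  have hcont := continuous_cosTransform hH
  set G : ℝ × EuclideanSpace ℝ (Fin d) → ℝ := fun p =>
    (cosTransform H (t + jump p) + cosTransform H (t - jump p)) / 2 * 1 with hG
  have hGc : Continuous G := by fun_prop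
  have hG0 : ∀ p, 0 ≤ G p := fun p => by
    have h₁ := hpos (t + jump p)
    have h₂ := hpos (t - jump p)
    simp only [hG]
    positivity
  have hGi : Integrable G (jumpMeasure d) := by
    refine Integrable.of_bound hGc.aestronglyMeasurable (∫ w, ‖H w‖) (.of_forall fun p => ?_)
    have h₁ := abs_cosTransform_le hH (t + jump p)
    have h₂ := abs_cosTransform_le hH (t - jump p)
    rw [Real.norm_of_nonneg (hG0 p)]
    simp only [hG]
    linarith [le_abs_self (cosTransform H (t + jump p)),
      le_abs_self (cosTransform H (t - jump p))]
  refine (integral_pos_iff_support_of_nonneg hG0 hGi).2 ?_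
  set O : Set (ℝ × EuclideanSpace ℝ (Fin d)) :=
    {p | 0 < cosTransform H (t - jump p)} ∩ Set.Ioo (0 : ℝ) 1 ×ˢ Metric.ball 0 1 with hO
  have hOo : IsOpen O := (isOpen_lt continuous_const (by fun_prop)).inter
    (isOpen_Ioo.prod Metric.isOpen_ball)
  have hOne : O.Nonempty := ⟨(s, y), by simpa [t] using hz, hs, by simpa using hy⟩
  have hsub : O ⊆ Function.support G := fun p hp => by
    have h₁ := hpos (t + jump p)
    have h₂ : 0 < cosTransform H (t - jump p) := hp.1
    refine ne_of_gt ?_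
    simp only [hG]
    positivity
  have hOμ : jumpMeasure d O = volume O := by
    rw [jumpMeasure_eq_restrict, Measure.restrict_eq_self]
    exact fun p hp => ⟨Set.Ioo_subset_Ioc_self hp.2.1, (mem_ball_zero_iff.1 hp.2.2).le⟩
  calc (0 : ENNReal) < volume O := hOo.measure_pos _ hOne
    _ = jumpMeasure d O := hOμ.symm
    _ ≤ _ := measure_mono hsub

lemma exists_cosTransform_mul_jumpCos_pow_pos {H : Phase d → ℝ} (hH : Integrable H)
    (hpos : ∀ z, 0 ≤ cosTransform H z) (h0 : 0 < cosTransform H 0) (z : Phase d) :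
    ∃ k : ℕ, 0 < cosTransform
      (fun w => H w * jumpCos (jumpMeasure d) jump (fun _ => 1) w ^ k) z := by
  set g := jumpCos (jumpMeasure d) jump fun _ => 1 with hg
  have hgP : IsPosMultiplier g := isPosMultiplier_jumpCos measurable_jump measurable_const
    (integrable_const _) (.of_forall fun _ => zero_le_one)
  have step : ∀ (s : ℝ), s ∈ Set.Ioo (0 : ℝ) 1 → ∀ y : EuclideanSpace ℝ (Fin d), ‖y‖ < 1 →
      ∀ (n k : ℕ) (z : Phase d), 0 < cosTransform (fun w => H w * g w ^ k) z →
        0 < cosTransform (fun w => H w * g w ^ (k + n)) (z + (n : ℝ) • jump (s, y)) := by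
    intro s hs y hy n k z hz
    induction n with
    | zero => simpa using hz
    | succ n ih =>
      have h := cosTransform_mul_jumpCos_pos ((hgP.pow _).integrable_mul hH)
        ((hgP.pow _).nonneg H hH hpos) ih hs hy
      convert h using 2
      · ext w
        rw [← add_assoc, pow_succ, ← mul_assoc]
      · push_cast
        module
  obtain ⟨n, hn⟩ := exists_nat_gt (‖(3 / 2 : ℝ) • z.2 - (2 : ℝ) • z.1‖ +
    ‖(2 : ℝ) • z.1 - (1 / 2 : ℝ) • z.2‖)
  set y₁ := (3 / 2 : ℝ) • z.2 - (2 : ℝ) • z.1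
  set y₂ := (2 : ℝ) • z.1 - (1 / 2 : ℝ) • z.2
  have hn0 : (0 : ℝ) < n := by linarith [norm_nonneg y₁, norm_nonneg y₂]
  have hy₁ : ‖(n : ℝ)⁻¹ • y₁‖ < 1 := by
    rw [norm_smul, Real.norm_of_nonneg (by positivity), inv_mul_lt_one₀ hn0]
    linarith [norm_nonneg y₂]
  have hy₂ : ‖(n : ℝ)⁻¹ • y₂‖ < 1 := by
    rw [norm_smul, Real.norm_of_nonneg (by positivity), inv_mul_lt_one₀ hn0]
    linarith [norm_nonneg y₁]
  have h := step (3 / 4) ⟨by norm_num, by norm_num⟩ _ hy₂ n _ _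
    (step (1 / 4) ⟨by norm_num, by norm_num⟩ _ hy₁ n 0 0 (by simpa using h0))
  refine ⟨0 + n + n, ?_⟩
  convert h using 2
  have hc : ∀ y : EuclideanSpace ℝ (Fin d), (n : ℝ) • ((n : ℝ)⁻¹ • y) = y := fun y =>
    smul_inv_smul₀ hn0.ne' y
  ext1
  · simp only [jump, Prod.fst_add, Prod.smul_fst, zero_add,
      smul_comm (n : ℝ) (_ : ℝ) ((n : ℝ)⁻¹ • _), hc, y₁, y₂]
    module
  · simp only [jump, Prod.snd_add, Prod.smul_snd, zero_add, hc, y₁, y₂]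
    module

/-- The density with unit coefficient is strictly positive everywhere. -/
lemma cosTransform_exp_neg_kineticExp_one_pos (hd : 1 ≤ d) {α : ℝ}
    (hα : α ∈ Set.Ioo (0 : ℝ) 2) (z : Phase d) :
    0 < cosTransform (fun w => exp (-kineticExp d α (fun _ => 1) w)) z := by
  have : Nonempty (Fin d) := ⟨⟨0, hd⟩⟩
  set μ := jumpMeasure d with hμ
  set g := jumpCos μ jump fun _ => 1 with hg
  have hgP : IsPosMultiplier g := isPosMultiplier_jumpCos measurable_jump measurable_const
    (integrable_const _) (.of_forall fun _ => zero_le_one)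
  set σ : ℝ × EuclideanSpace ℝ (Fin d) → ℝ := fun p => stableWeight d α p.2 - 1 with hσ
  have hσm : Measurable σ := by fun_prop
  have hσpos : 0 ≤ᵐ[μ] σ := by
    have hne : ∀ᵐ p ∂μ, p.2 ≠ 0 := by
      rw [hμ, jumpMeasure]
      exact Measure.quasiMeasurePreserving_snd.ae (ae_restrict_of_ae (Measure.ae_ne volume 0))
    filter_upwards [ae_jumpMeasure, hne] with p hp hp0
    have hα0 := hα.1
    exact sub_nonneg.2 (one_le_rpow_of_pos_of_le_one_of_nonpos (norm_pos_iff.2 hp0) hp.2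
      (by linarith [d.cast_nonneg (α := ℝ)]))
  have hint1 : ∀ w, Integrable (fun p => (1 - cos (pairing w (jump p))) * 1) μ := fun w => by
    refine Integrable.of_bound (C := 2) ?_ (.of_forall fun p => ?_)
    · exact (by fun_prop : Measurable _).aestronglyMeasurable
    · have h1 := neg_one_le_cos (pairing w (jump p))
      have h2 := cos_le_one (pairing w (jump p))
      rw [mul_one, Real.norm_of_nonneg (by linarith)]
      linarith
  have hintσ : ∀ w, Integrable (fun p => (1 - cos (pairing w (jump p))) * σ p) μ := fun w => by
    have h := (integrable_one_sub_cos_jump (K := 1) (k := fun _ => 1) hd hα.2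
      measurable_const (by simp) w).sub (hint1 w)
    refine h.congr (.of_forall fun p => ?_)
    simp only [hσ, Pi.sub_apply]
    ring
  set L := ∫ _, (1 : ℝ) ∂μ
  set Hs : Phase d → ℝ := fun w => exp (-levyExp μ jump σ w) with hHs
  have hsplit : ∀ w, kineticExp d α (fun _ => 1) w = levyExp μ jump σ w + (L - g w) := fun w => by
    rw [← levyExp_eq_sub_jumpCos measurable_jump (integrable_const _),
      ← levyExp_add w (hintσ w) (hint1 w), kineticExp]
    congr 1
    ext p
    simp only [hσ]
    ring
  have hHsP : IsPosMultiplier Hs :=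
    isPosMultiplier_exp_neg_levyExp measurable_jump hσm hσpos hintσ
  have hHsi : Integrable Hs := by
    refine ((integrable_exp_neg_kineticExp_one hd hα).const_mul (exp (2 * L))).mono'
      hHsP.measurable.aestronglyMeasurable (.of_forall fun w => ?_)
    rw [Real.norm_of_nonneg (exp_pos _).le, ← exp_add, hsplit]
    have h := abs_jumpCos_le measurable_jump (μ := μ) (integrable_const (1 : ℝ)) w
    simp only [norm_one] at h
    exact exp_le_exp.2 (by linarith [neg_abs_le (g w)])
  have hHs0 : ∀ z, 0 ≤ cosTransform Hs z := hHsP.cosTransform_nonneg hHsi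
  have hzero : 0 < cosTransform Hs 0 := by
    have h : cosTransform Hs 0 = ∫ w, Hs w := by simp [cosTransform, pairing]
    rw [h, integral_pos_iff_support_of_nonneg (fun w => (exp_pos _).le) hHsi]
    have hs : Function.support Hs = Set.univ := Set.eq_univ_of_forall fun w => (exp_pos _).ne'
    rw [hs]
    exact isOpen_univ.measure_pos _ Set.univ_nonempty
  obtain ⟨k, hk⟩ := exists_cosTransform_mul_jumpCos_pow_pos hHsi hHs0 hzero z
  have h := (hgP.exp_sub_pow k).nonneg Hs hHsi hHs0 z
  have hk' : 0 < cosTransform (fun w => Hs w * g w ^ k * (1 / (k.factorial : ℝ))) z := by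
    rw [cosTransform_mul_const]
    positivity
  have h1 : cosTransform (fun w => Hs w * (exp (g w) - g w ^ k / k.factorial)) z =
      cosTransform (fun w => Hs w * exp (g w)) z -
        cosTransform (fun w => Hs w * g w ^ k * (1 / (k.factorial : ℝ))) z := by
    rw [← cosTransform_sub (hgP.exp.integrable_mul hHsi)
      (((hgP.pow k).integrable_mul hHsi).mul_const _)]
    congr 1
    ext w
    ring
  have h2 : (fun w => exp (-kineticExp d α (fun _ => 1) w)) =
      fun w => Hs w * exp (g w) * exp (-L) := by
    ext w
    rw [hsplit, hHs, ← exp_add, ← exp_add]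
    ring_nf
  rw [h2, cosTransform_mul_const]
  exact mul_pos (by linarith) (exp_pos _)

end StrictPositivity

section LowerBound

variable {d : ℕ}

/-- A positive Gaussian mixture whose cosine transform is nonpositive far from the origin. -/
noncomputable def bumpWeight (w : Phase d) : ℝ := gauss (1 / 2) w * 2 - gauss 1 w

lemma integrable_bumpWeight : Integrable (bumpWeight (d := d)) :=
  ((integrable_gauss (by norm_num)).mul_const 2).sub (integrable_gauss one_pos)

lemma gauss_half_le_bumpWeight (w : Phase d) : gauss (1 / 2) w ≤ bumpWeight w := by
  have h : gauss 1 w ≤ gauss (1 / 2) w :=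
    exp_le_exp.2 (by nlinarith [sq_nonneg ‖w.1‖, sq_nonneg ‖w.2‖])
  unfold bumpWeight
  linarith

lemma cosTransform_bumpWeight (z : Phase d) :
    cosTransform bumpWeight z =
      2 * (2 * π) ^ d * gauss (1 / 2) z - π ^ d * gauss (1 / 4) z := by
  have h := cosTransform_sub ((integrable_gauss (d := d) (b := 1 / 2) (by norm_num)).mul_const 2)
    (integrable_gauss one_pos) z
  rw [cosTransform_mul_const, cosTransform_gauss (by norm_num), cosTransform_gauss one_pos] at h
  refine h.trans ?_
  norm_num
  ring

lemma cosTransform_bumpWeight_le (z : Phase d) :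
    cosTransform bumpWeight z ≤ 2 * (2 * π) ^ d := by
  rw [cosTransform_bumpWeight]
  have h1 : gauss (1 / 2) z ≤ 1 :=
    exp_le_one_iff.2 (by nlinarith [sq_nonneg ‖z.1‖, sq_nonneg ‖z.2‖])
  have h2 : 0 ≤ π ^ d * gauss (1 / 4) z := mul_nonneg (by positivity) (gauss_pos _ _).le
  have h3 : 2 * (2 * π) ^ d * gauss (1 / 2) z ≤ 2 * (2 * π) ^ d :=
    mul_le_of_le_one_right (by positivity) h1
  linarith

lemma sq_norm_le (z : Phase d) : ‖z‖ ^ 2 ≤ ‖z.1‖ ^ 2 + ‖z.2‖ ^ 2 := by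
  rcases max_cases ‖z.1‖ ‖z.2‖ with h | h <;> rw [Prod.norm_def, h.1] <;>
    nlinarith [sq_nonneg ‖z.1‖, sq_nonneg ‖z.2‖]

lemma cosTransform_bumpWeight_nonpos {z : Phase d} (hz : 2 * ((d : ℝ) + 1) ≤ ‖z‖) :
    cosTransform bumpWeight z ≤ 0 := by
  have hsq : gauss (1 / 2) z = gauss (1 / 4) z * gauss (1 / 4) z := by
    simp only [gauss, ← exp_add]
    ring_nf
  have hd : (0 : ℝ) ≤ d := d.cast_nonneg
  have h1 : gauss (1 / 4) z ≤ exp (-((d + 1 : ℕ) : ℝ)) := by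
    refine exp_le_exp.2 ?_
    push_cast
    nlinarith [sq_norm_le z]
  have h2 : (2 : ℝ) ^ (d + 1) ≤ exp ((d + 1 : ℕ) : ℝ) := by
    rw [← mul_one ((d + 1 : ℕ) : ℝ), exp_nat_mul]
    have := add_one_le_exp (1 : ℝ)
    gcongr
    linarith
  have h3 : 2 ^ (d + 1) * gauss (1 / 4) z ≤ 1 :=
    calc 2 ^ (d + 1) * gauss (1 / 4) z
        ≤ exp ((d + 1 : ℕ) : ℝ) * exp (-((d + 1 : ℕ) : ℝ)) :=
          mul_le_mul h2 h1 (gauss_pos _ _).le (exp_pos _).le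
      _ = 1 := by rw [← exp_add, add_neg_cancel, exp_zero]
  have h4 : 0 ≤ π ^ d * gauss (1 / 4) z := mul_nonneg (by positivity) (gauss_pos _ _).le
  rw [cosTransform_bumpWeight, hsq, mul_pow]
  calc 2 * (2 ^ d * π ^ d) * (gauss (1 / 4) z * gauss (1 / 4) z) - π ^ d * gauss (1 / 4) z
      = π ^ d * gauss (1 / 4) z * (2 ^ (d + 1) * gauss (1 / 4) z - 1) := by ring
    _ ≤ 0 := mul_nonpos_of_nonneg_of_nonpos h4 (by linarith)

/-- A positive continuous function dominates a multiple of all nearby translated bumps. -/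
lemma exists_mul_bump_le {u : Phase d → ℝ} (hu : Continuous u) (hpos : ∀ z, 0 < u z) :
    ∃ c > 0, ∀ a : Phase d, ‖a‖ ≤ 1 → ∀ z, c * cosTransform bumpWeight (z + a) ≤ u z := by
  set R : ℝ := 2 * ((d : ℝ) + 1) + 1
  have hR : 0 ≤ R := by positivity
  obtain ⟨z₀, -, hz₀⟩ := (isCompact_closedBall (0 : Phase d) R).exists_isMinOn
    ⟨0, by simpa using hR⟩ hu.continuousOn
  have hK : 0 < 2 * (2 * π) ^ d := by positivity
  refine ⟨u z₀ / (2 * (2 * π) ^ d), div_pos (hpos z₀) hK, fun a ha z => ?_⟩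
  by_cases h : 2 * ((d : ℝ) + 1) ≤ ‖z + a‖
  · exact (mul_nonpos_of_nonneg_of_nonpos (div_pos (hpos z₀) hK).le
      (cosTransform_bumpWeight_nonpos h)).trans (hpos z).le
  · have hz : z ∈ Metric.closedBall (0 : Phase d) R := by
      rw [mem_closedBall_zero_iff]
      have := norm_sub_le (z + a) a
      rw [add_sub_cancel_right] at this
      linarith
    calc u z₀ / (2 * (2 * π) ^ d) * cosTransform bumpWeight (z + a)
        ≤ u z₀ / (2 * (2 * π) ^ d) * (2 * (2 * π) ^ d) :=
          mul_le_mul_of_nonneg_left (cosTransform_bumpWeight_le _) (div_pos (hpos z₀) hK).le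
      _ = u z₀ := div_mul_cancel₀ _ hK.ne'
      _ ≤ u z := hz₀ hz

/-- Adding further independent symmetric jumps preserves a bump lower bound. -/
lemma IsPosMultiplier.mul_integral_le {g H : Phase d → ℝ} (hg : IsPosMultiplier g)
    (hH : Integrable H) {c : ℝ} {z : Phase d}
    (hadd : ∀ t, c * cosTransform bumpWeight (t + z) ≤ cosTransform H t)
    (hsub : ∀ t, c * cosTransform bumpWeight (t - z) ≤ cosTransform H t) :
    c * ∫ w, cos (pairing w z) ^ 2 * bumpWeight w * g w ≤
      cosTransform (fun w => H w * g w) z := by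
  set P : Phase d → ℝ := fun w => bumpWeight w * cos (pairing w z) * c with hP
  have hPi : Integrable P := by
    refine Integrable.mul_const ?_ c
    simpa only [mul_comm] using integrable_cos_mul integrable_bumpWeight z
  have h := hg.nonneg (fun w => H w - P w) (hH.sub hPi) (fun t => ?_) z
  · have h1 : cosTransform (fun w => (H w - P w) * g w) z =
        cosTransform (fun w => H w * g w) z - cosTransform (fun w => P w * g w) z := by
      simp only [sub_mul]
      exact cosTransform_sub (hg.integrable_mul hH) (hg.integrable_mul hPi) z
    have h2 : cosTransform (fun w => P w * g w) z =
        c * ∫ w, cos (pairing w z) ^ 2 * bumpWeight w * g w := by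
      rw [cosTransform, ← integral_const_mul]
      congr 1 with w
      simp only [hP]
      ring
    linarith
  · rw [cosTransform_sub hH hPi, cosTransform_mul_const,
      cosTransform_mul_cos integrable_bumpWeight]
    linarith [hadd t, hsub t]

lemma setIntegral_annulus_pos (hd : 1 ≤ d) {α : ℝ} (hα : α < 2) :
    0 < ∫ y in {y : EuclideanSpace ℝ (Fin d) | 1 / 3 < ‖y‖ ∧ ‖y‖ ≤ 1},
      ‖y‖ ^ (-(d : ℝ) - α) := by
  have : Nonempty (Fin d) := ⟨⟨0, hd⟩⟩
  set A := {y : EuclideanSpace ℝ (Fin d) | 1 / 3 < ‖y‖ ∧ ‖y‖ ≤ 1} with hA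
  have hAm : MeasurableSet A := (measurableSet_lt measurable_const measurable_norm).inter
    (measurableSet_le measurable_norm measurable_const)
  have hint : IntegrableOn (fun y => ‖y‖ ^ (-(d : ℝ) - α)) A := by
    refine ((integrable_sq_norm_mul_stableWeight hd hα).mono_set
      fun y hy => hy.2).const_mul 9 |>.mono' ?_ ?_
    · exact (measurable_stableWeight α).aestronglyMeasurable
    · filter_upwards [ae_restrict_mem hAm] with y hy
      have hs := stableWeight_nonneg α y
      change ‖stableWeight d α y‖ ≤ _
      rw [Real.norm_of_nonneg hs, ← mul_assoc]
      refine le_mul_of_one_le_left hs ?_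
      nlinarith [hy.1]
  refine (setIntegral_pos_iff_support_of_nonneg_ae
    (.of_forall fun y => stableWeight_nonneg α y) hint).2 ?_
  obtain ⟨y₀, hy₀⟩ := exists_norm_eq (EuclideanSpace ℝ (Fin d)) (c := 1 / 2) (by norm_num)
  have hO : IsOpen {y : EuclideanSpace ℝ (Fin d) | 1 / 3 < ‖y‖ ∧ ‖y‖ < 1} :=
    (isOpen_lt continuous_const continuous_norm).inter (isOpen_lt continuous_norm continuous_const)
  refine (hO.measure_pos volume ⟨y₀, by rw [hy₀]; norm_num, by rw [hy₀]; norm_num⟩).trans_le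
    (measure_mono fun y hy => ⟨?_, hy.1, hy.2.le⟩)
  have : 0 < ‖y‖ := by linarith [hy.1]
  exact (rpow_pos_of_pos this _).ne'

/-- A small ball contributes a uniform amount to the bump integral. -/
lemma mul_exp_le_integral_bump {g : Phase d → ℝ} (hg : IsPosMultiplier g)
    (hg0 : ∀ w, 0 ≤ g w) {δ m : ℝ} (hδ : δ ≤ 1 / 2) (hm : 0 ≤ m)
    (hgm : ∀ w, ‖w‖ < δ → m ≤ g w) {z : Phase d} (hz : ‖z‖ ≤ 1) :
    1 / 4 * exp (-1) * (volume : Measure (Phase d)).real (Metric.ball 0 δ) * m ≤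
      ∫ w, cos (pairing w z) ^ 2 * bumpWeight w * g w := by
  set f : Phase d → ℝ := fun w => cos (pairing w z) ^ 2 * bumpWeight w * g w with hf
  have hb0 : ∀ w : Phase d, 0 ≤ bumpWeight w := fun w =>
    (gauss_pos _ w).le.trans (gauss_half_le_bumpWeight w)
  have hf0 : ∀ w, 0 ≤ f w := fun w => mul_nonneg (mul_nonneg (sq_nonneg _) (hb0 w)) (hg0 w)
  have hfi : Integrable f := by
    have h := integrable_cos_mul (integrable_cos_mul (hg.integrable_mul integrable_bumpWeight) z) z
    refine h.congr (.of_forall fun w => ?_)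
    simp only [hf]
    ring
  have hlow : ∀ w ∈ Metric.ball (0 : Phase d) δ, 1 / 4 * exp (-1) * m ≤ f w := fun w hw => by
    have hwδ : ‖w‖ < δ := mem_ball_zero_iff.1 hw
    have hw0 := norm_nonneg w
    have hp : |pairing w z| ≤ 1 := (abs_pairing_le w z).trans (by
      nlinarith [norm_nonneg z])
    have hc : 1 / 2 ≤ cos (pairing w z) := by
      have h1 := one_sub_sq_div_two_le_cos (x := pairing w z)
      have h2 := (sq_le_one_iff_abs_le_one _).2 hp
      linarith
    have hc2 : 1 / 4 ≤ cos (pairing w z) ^ 2 := by nlinarith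
    have hb : exp (-1) ≤ bumpWeight w := by
      refine le_trans (exp_le_exp.2 ?_) (gauss_half_le_bumpWeight w)
      have h1 := norm_fst_le w
      have h2 := norm_snd_le w
      nlinarith [norm_nonneg w.1, norm_nonneg w.2]
    have := hgm w hwδ
    have := hb0 w
    simp only [hf]
    gcongr
  calc 1 / 4 * exp (-1) * (volume : Measure (Phase d)).real (Metric.ball 0 δ) * m
      = ∫ _ in Metric.ball (0 : Phase d) δ, 1 / 4 * exp (-1) * m := by
        rw [setIntegral_const, smul_eq_mul]
        ring
    _ ≤ ∫ w in Metric.ball (0 : Phase d) δ, f w :=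
        setIntegral_mono_on (integrableOn_const measure_ball_lt_top.ne) hfi.integrableOn
          Metric.isOpen_ball.measurableSet hlow
    _ ≤ ∫ w, f w := setIntegral_le_integral hfi (.of_forall hf0)

lemma kineticExp_eq_one_add (hd : 1 ≤ d) {α K : ℝ} (hα : α < 2)
    {k : EuclideanSpace ℝ (Fin d) → ℝ} (hkm : Measurable k) (hk : ∀ y, |k y - 1| ≤ K)
    (w : Phase d) :
    kineticExp d α k w =
      kineticExp d α (fun _ => 1) w + kineticExp d α (fun y => k y - 1) w := by
  simp only [kineticExp]
  rw [← levyExp_add w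
    (integrable_one_sub_cos_jump (K := 1) (k := fun _ => 1) hd hα measurable_const (by simp) w)
    (integrable_one_sub_cos_jump (k := fun y => k y - 1) hd hα (hkm.sub_const 1) hk w)]
  congr 1
  ext p
  ring

end LowerBound

end KineticDensity

open KineticDensity in
/-- quantitative strict positivity of the small-jump density on the unit
cube, with `ĉ = ∫_{1/3<|y|≤1} |y|^{−d−α} dy`. -/
theorem stmt_17 (d : ℕ) (hd : 1 ≤ d) (α : ℝ) (hα : α ∈ Set.Ioo (0 : ℝ) 2) :
    ∃ C₁ > (0 : ℝ), ∀ (κ : EuclideanSpace ℝ (Fin d) → ℝ) (κ₁ : ℝ), 1 ≤ κ₁ →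
      Measurable κ → (∀ y, 1 ≤ κ y ∧ κ y ≤ κ₁) → (∀ y, κ (-y) = κ y) →
      ∀ x v : EuclideanSpace ℝ (Fin d), ‖x‖ ≤ 1 → ‖v‖ ≤ 1 →
        C₁ * Real.exp (-(∫ y in {y : EuclideanSpace ℝ (Fin d) |
              1 / 3 < ‖y‖ ∧ ‖y‖ ≤ 1}, ‖y‖ ^ (-(d : ℝ) - α)) * κ₁) ≤
          qK d α κ (x, v) := by
  have hĉ := setIntegral_annulus_pos hd hα.2
  set ĉ := ∫ y in {y : EuclideanSpace ℝ (Fin d) | 1 / 3 < ‖y‖ ∧ ‖y‖ ≤ 1},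
    ‖y‖ ^ (-(d : ℝ) - α)
  have hint₀ := integrable_exp_neg_kineticExp_one hd hα
  obtain ⟨c, hc, hbump⟩ := exists_mul_bump_le (continuous_cosTransform hint₀)
    (cosTransform_exp_neg_kineticExp_one_pos hd hα)
  set M := ∫ p, ‖p.2‖ ^ 2 * stableWeight d α p.2 ∂jumpMeasure d with hM
  have hM0 : 0 ≤ M := integral_nonneg fun p =>
    mul_nonneg (sq_nonneg _) (stableWeight_nonneg α p.2)
  set δ := min (1 / 2) √(ĉ / (2 * M + 1)) with hδ
  have hδ0 : 0 < δ := lt_min (by norm_num) (sqrt_pos.2 (by positivity))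
  have hδM : 2 * M * δ ^ 2 ≤ ĉ := by
    have h1 : δ ^ 2 ≤ ĉ / (2 * M + 1) := (le_sqrt' hδ0).1 (min_le_right _ _)
    rw [le_div_iff₀ (by positivity)] at h1
    nlinarith [sq_nonneg δ]
  have hvol : 0 < (volume : Measure (Phase d)).real (Metric.ball 0 δ) :=
    ENNReal.toReal_pos (Metric.measure_ball_pos _ _ hδ0).ne' measure_ball_lt_top.ne
  refine ⟨(2 * π) ^ (-(2 * (d : ℝ))) * (c * (1 / 4 * exp (-1) *
    (volume : Measure (Phase d)).real (Metric.ball 0 δ))), by positivity, ?_⟩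
  intro κ κ₁ hκ₁ hκm hκ _ x v hx hv
  have hz : ‖((x, v) : Phase d)‖ ≤ 1 := max_le hx hv
  have hκabs : ∀ y, |κ y| ≤ κ₁ := fun y => by
    rw [abs_of_nonneg (by linarith [(hκ y).1])]
    exact (hκ y).2
  have hκ1abs : ∀ y, |κ y - 1| ≤ κ₁ := fun y => by
    rw [abs_of_nonneg (by linarith [(hκ y).1])]
    linarith [(hκ y).2]
  have hκ1m : Measurable fun y => κ y - 1 := hκm.sub_const 1
  set g : Phase d → ℝ := fun w => exp (-kineticExp d α (fun y => κ y - 1) w) with hg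
  have hgP : IsPosMultiplier g := by
    refine isPosMultiplier_exp_neg_levyExp measurable_jump (by fun_prop)
      (.of_forall fun p => mul_nonneg (sub_nonneg.2 (hκ p.2).1) (stableWeight_nonneg α p.2))
      (integrable_one_sub_cos_jump (k := fun y => κ y - 1) hd hα.2 hκ1m hκ1abs)
  have hglow : ∀ w : Phase d, ‖w‖ < δ → exp (-ĉ * κ₁) ≤ g w := fun w hw => by
    refine exp_le_exp.2 ?_
    have h1 := kineticExp_le hd hα.2 hκ1m hκ1abs w
    have h2 : ‖w‖ ^ 2 ≤ δ ^ 2 := by gcongr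
    have h3 : 2 * κ₁ * ‖w‖ ^ 2 * M ≤ 2 * κ₁ * δ ^ 2 * M := by gcongr
    have h4 : κ₁ * (2 * M * δ ^ 2) ≤ κ₁ * ĉ := by gcongr
    linarith
  have hball := mul_exp_le_integral_bump hgP (fun w => (exp_pos _).le) (min_le_left _ _)
    (exp_pos _).le hglow hz
  have hmain := hgP.mul_integral_le hint₀ (hbump (x, v) hz) (fun t => by
    rw [sub_eq_add_neg]
    exact hbump (-(x, v)) (by rwa [norm_neg]) t)
  have hq : qK d α κ (x, v) = (2 * π) ^ (-(2 * (d : ℝ))) *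
      cosTransform (fun w => exp (-kineticExp d α (fun _ => 1) w) * g w) (x, v) := by
    rw [qK, phiK_eq_kineticExp hd hα.2 hκm hκabs]
    congr 2 with w
    rw [kineticExp_eq_one_add hd hα.2 hκm hκ1abs, neg_add, exp_add]
    rfl
  rw [hq, mul_assoc, mul_assoc c]
  gcongr
  exact (mul_le_mul_of_nonneg_left hball hc.le).trans hmain
end

section
/- Let d ≥ 1, α ∈ (0,2), and q_x, q_v ≥ 0 with q_x + q_v < α. Then ∫_{ℝ^d×ℝ^d} |x|^{q_x} |v|^{q_v} 𝒩_{d+α}(x,v) dx dv < ∞. -/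
open MeasureTheory Real RealInnerProductSpace

/-- The function `𝒩_β`. -/
noncomputable def kinN (d : ℕ) (β : ℝ) (x v : EuclideanSpace ℝ (Fin d)) : ℝ :=
  (1 + Real.sqrt (‖x‖ ^ 2 + ‖v‖ ^ 2)) ^ (-(1 + β)) *
    (1 + ⨅ s : Set.Icc (0 : ℝ) 1, ‖x - (s : ℝ) • v‖) ^ (1 - β)

section Helpers

variable {E : Type*} [NormedAddCommGroup E] [NormedSpace ℝ E]

/-- Away from the cone `‖x‖ ≤ 2 ‖v‖`, the distance from `x` to the segment `[0, v]` is comparable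
to `‖x‖`. -/
theorem one_add_norm_le_three_mul_one_add_iInf {x v : E} (h : 2 * ‖v‖ < ‖x‖) :
    1 + ‖x‖ ≤ 3 * (1 + ⨅ s : Set.Icc (0 : ℝ) 1, ‖x - (s : ℝ) • v‖) := by
  have : ‖x‖ / 2 ≤ ⨅ s : Set.Icc (0 : ℝ) 1, ‖x - (s : ℝ) • v‖ := by
    refine le_ciInf fun s => ?_
    have h1 : ‖x‖ - ‖(s : ℝ) • v‖ ≤ ‖x - (s : ℝ) • v‖ := norm_sub_norm_le _ _
    have h2 : ‖(s : ℝ) • v‖ ≤ ‖v‖ := by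
      rw [norm_smul, Real.norm_of_nonneg s.2.1]
      exact mul_le_of_le_one_left (norm_nonneg _) s.2.2
    linarith
  linarith [norm_nonneg x]

/-- Near the cone, a power of the distance to the segment `[0, v]` is controlled by an average
along the line spanned by `v`, with a gain of one power. -/
theorem rpow_one_add_iInf_le_lintegral {β : ℝ} (hβ : 0 ≤ β) {x v : E} (h : ‖x‖ ≤ 2 * ‖v‖) :
    ENNReal.ofReal
        ((1 + ‖v‖)⁻¹ * (1 + ⨅ s : Set.Icc (0 : ℝ) 1, ‖x - (s : ℝ) • v‖) ^ (1 - β)) ≤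
      ENNReal.ofReal (3 ^ β) *
        ∫⁻ s in Set.Icc (0 : ℝ) 3, ENNReal.ofReal ((1 + ‖x - s • v‖) ^ (-β)) := by
  have hbdd : BddBelow (Set.range fun s : Set.Icc (0 : ℝ) 1 => ‖x - (s : ℝ) • v‖) :=
    ⟨0, by rintro _ ⟨s, rfl⟩; exact norm_nonneg _⟩
  have hle : (⨅ s : Set.Icc (0 : ℝ) 1, ‖x - (s : ℝ) • v‖) ≤ ‖x‖ := by
    simpa using ciInf_le hbdd ⟨0, by simp⟩
  have h0 : 0 ≤ ⨅ s : Set.Icc (0 : ℝ) 1, ‖x - (s : ℝ) • v‖ :=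
    Real.iInf_nonneg fun s => norm_nonneg _
  obtain ⟨⟨t, ht0, ht1⟩, ht⟩ :=
    exists_lt_of_ciInf_lt (lt_add_one (⨅ s : Set.Icc (0 : ℝ) 1, ‖x - (s : ℝ) • v‖))
  set D := ⨅ s : Set.Icc (0 : ℝ) 1, ‖x - (s : ℝ) • v‖
  simp only at ht
  have hv := norm_nonneg v
  have hv1 : 0 < 1 + ‖v‖ := by linarith
  have hD : 0 < 1 + D := by linarith
  set l := (1 + D) / (1 + ‖v‖) with hl
  have hl0 : 0 ≤ l := by positivity
  have hl2 : l ≤ 2 := by rw [hl, div_le_iff₀ hv1]; linarith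
  have hlv : l * ‖v‖ ≤ 1 + D := by
    rw [hl, div_mul_eq_mul_div, div_le_iff₀ hv1]
    nlinarith
  have hpt : ∀ s ∈ Set.Icc t (t + l), 3 ^ (-β) * (1 + D) ^ (-β) ≤ (1 + ‖x - s • v‖) ^ (-β) := by
    intro s hs
    rw [← Real.mul_rpow (by norm_num) hD.le]
    refine Real.rpow_le_rpow_of_nonpos (by positivity) ?_ (by linarith)
    have h1 : x - s • v = (x - t • v) - (s - t) • v := by rw [sub_smul]; abel
    have h2 : ‖(s - t) • v‖ ≤ l * ‖v‖ := by
      rw [norm_smul, Real.norm_of_nonneg (by linarith [hs.1])]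
      exact mul_le_mul_of_nonneg_right (by linarith [hs.2]) hv
    have h3 := norm_sub_le (x - t • v) ((s - t) • v)
    rw [h1]
    linarith
  calc ENNReal.ofReal ((1 + ‖v‖)⁻¹ * (1 + D) ^ (1 - β))
      = ENNReal.ofReal (3 ^ β) * (ENNReal.ofReal (3 ^ (-β) * (1 + D) ^ (-β)) *
          volume (Set.Icc t (t + l))) := by
        rw [Real.volume_Icc, ← ENNReal.ofReal_mul (by positivity),
          ← ENNReal.ofReal_mul (by positivity)]
        congr 1
        have h3 : (3 : ℝ) ^ β * 3 ^ (-β) = 1 := by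
          rw [← Real.rpow_add (by norm_num), add_neg_cancel, Real.rpow_zero]
        rw [sub_eq_add_neg 1 β, Real.rpow_add hD, Real.rpow_one, add_sub_cancel_left, hl,
          div_eq_mul_inv]
        linear_combination -((1 + ‖v‖)⁻¹ * (1 + D) * (1 + D) ^ (-β)) * h3
    _ = ENNReal.ofReal (3 ^ β) *
          ∫⁻ _ in Set.Icc t (t + l), ENNReal.ofReal (3 ^ (-β) * (1 + D) ^ (-β)) := by
        rw [setLIntegral_const]
    _ ≤ ENNReal.ofReal (3 ^ β) *
          ∫⁻ s in Set.Icc t (t + l), ENNReal.ofReal ((1 + ‖x - s • v‖) ^ (-β)) := by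
        gcongr 1
        exact setLIntegral_mono' measurableSet_Icc fun s hs => ENNReal.ofReal_le_ofReal (hpt s hs)
    _ ≤ _ := by
        gcongr 1
        exact lintegral_mono_set (Set.Icc_subset_Icc ht0 (by linarith))

end Helpers

/-- Pointwise bound of the weighted `kinN` by a function integrable in `x`, then in `v`. -/
theorem ofReal_norm_rpow_mul_kinN_le {d : ℕ} {β qx qv : ℝ} (hβ : 1 ≤ β) (hqx : 0 ≤ qx)
    (hqv : 0 ≤ qv) (hq : qx + qv ≤ β) (x v : EuclideanSpace ℝ (Fin d)) :
    ENNReal.ofReal (‖x‖ ^ qx * ‖v‖ ^ qv * kinN d β x v) ≤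
      ENNReal.ofReal (3 ^ β) * (ENNReal.ofReal ((1 + ‖v‖) ^ (-(β - (qx + qv)))) *
        (ENNReal.ofReal ((1 + ‖x‖) ^ (-β)) +
          ∫⁻ s in Set.Icc (0 : ℝ) 3, ENNReal.ofReal ((1 + ‖x - s • v‖) ^ (-β)))) := by
  unfold kinN
  have hD0 : 0 ≤ ⨅ s : Set.Icc (0 : ℝ) 1, ‖x - (s : ℝ) • v‖ :=
    Real.iInf_nonneg fun s => norm_nonneg _
  have hcone := one_add_norm_le_three_mul_one_add_iInf (x := x) (v := v)
  have hint := rpow_one_add_iInf_le_lintegral (by linarith : 0 ≤ β) (x := x) (v := v)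
  set D := ⨅ s : Set.Icc (0 : ℝ) 1, ‖x - (s : ℝ) • v‖
  set r := Real.sqrt (‖x‖ ^ 2 + ‖v‖ ^ 2)
  have hxr : ‖x‖ ≤ r := Real.le_sqrt_of_sq_le (by nlinarith [sq_nonneg ‖v‖])
  have hvr : ‖v‖ ≤ r := Real.le_sqrt_of_sq_le (by nlinarith [sq_nonneg ‖x‖])
  have hx := norm_nonneg x
  have hv := norm_nonneg v
  have hr : 0 < 1 + r := by linarith
  have hw : ‖x‖ ^ qx * ‖v‖ ^ qv ≤ (1 + r) ^ (qx + qv) := by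
    rw [Real.rpow_add hr]
    gcongr <;> linarith
  have key : ‖x‖ ^ qx * ‖v‖ ^ qv * (1 + r) ^ (-(1 + β)) ≤
      (1 + ‖v‖) ^ (-(β - (qx + qv))) * (1 + r)⁻¹ := by
    calc _ ≤ (1 + r) ^ (qx + qv) * (1 + r) ^ (-(1 + β)) := by gcongr
      _ = (1 + r) ^ (-(β - (qx + qv))) * (1 + r)⁻¹ := by
        rw [← Real.rpow_neg_one, ← Real.rpow_add hr, ← Real.rpow_add hr]
        congr 1; ring
      _ ≤ _ := by
        gcongr ?_ * _
        exact Real.rpow_le_rpow_of_nonpos (by linarith) (by linarith) (by linarith)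
  rcases le_or_gt ‖x‖ (2 * ‖v‖) with h | h
  · calc _ ≤ ENNReal.ofReal ((1 + ‖v‖) ^ (-(β - (qx + qv))) *
          ((1 + ‖v‖)⁻¹ * (1 + D) ^ (1 - β))) := by
          apply ENNReal.ofReal_le_ofReal
          rw [← mul_assoc, ← mul_assoc]
          refine mul_le_mul_of_nonneg_right (key.trans ?_) (by positivity)
          gcongr
      _ ≤ ENNReal.ofReal ((1 + ‖v‖) ^ (-(β - (qx + qv)))) * (ENNReal.ofReal (3 ^ β) *
          ∫⁻ s in Set.Icc (0 : ℝ) 3, ENNReal.ofReal ((1 + ‖x - s • v‖) ^ (-β))) := by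
          rw [ENNReal.ofReal_mul (by positivity)]
          gcongr 1
          exact hint h
      _ ≤ _ := by
          rw [mul_left_comm]
          gcongr
          exact le_add_self
  · calc _ ≤ ENNReal.ofReal (3 ^ β * ((1 + ‖v‖) ^ (-(β - (qx + qv))) * (1 + ‖x‖) ^ (-β))) := by
          apply ENNReal.ofReal_le_ofReal
          have hD : (1 + D) ^ (1 - β) ≤ 3 ^ β * (1 + ‖x‖) ^ (1 - β) := by
            calc (1 + D) ^ (1 - β) ≤ ((1 + ‖x‖) / 3) ^ (1 - β) :=
                  Real.rpow_le_rpow_of_nonpos (by positivity) (by linarith [hcone h])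
                    (by linarith)
              _ = 3 ^ (β - 1) * (1 + ‖x‖) ^ (1 - β) := by
                  rw [Real.div_rpow (by positivity) (by norm_num), div_eq_mul_inv,
                    ← Real.rpow_neg (by norm_num), neg_sub, mul_comm]
              _ ≤ _ := by
                  gcongr <;> linarith
          calc _ = ‖x‖ ^ qx * ‖v‖ ^ qv * (1 + r) ^ (-(1 + β)) * (1 + D) ^ (1 - β) := by ring
            _ ≤ ((1 + ‖v‖) ^ (-(β - (qx + qv))) * (1 + ‖x‖)⁻¹) *
                (3 ^ β * (1 + ‖x‖) ^ (1 - β)) := by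
                refine mul_le_mul (key.trans ?_) hD (by positivity) (by positivity)
                gcongr
            _ = _ := by
                have hx1 : 0 < 1 + ‖x‖ := by linarith
                rw [sub_eq_add_neg 1 β, Real.rpow_add hx1, Real.rpow_one]
                field_simp
      _ ≤ _ := by
          rw [ENNReal.ofReal_mul (by positivity), ENNReal.ofReal_mul (by positivity)]
          gcongr
          exact le_self_add

/-- finiteness of joint moments of `𝒩_{d+α}` of total order below `α`. -/
theorem stmt_18 (d : ℕ) (hd : 1 ≤ d) (α : ℝ) (hα : α ∈ Set.Ioo (0 : ℝ) 2)
    (qx qv : ℝ) (hqx : 0 ≤ qx) (hqv : 0 ≤ qv) (hq : qx + qv < α) :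
    ∫⁻ z : EuclideanSpace ℝ (Fin d) × EuclideanSpace ℝ (Fin d),
      ENNReal.ofReal (‖z.1‖ ^ qx * ‖z.2‖ ^ qv * kinN d ((d : ℝ) + α) z.1 z.2) < ⊤ := by
  have hα0 := hα.1
  have hd1 : (1 : ℝ) ≤ d := by exact_mod_cast hd
  set β : ℝ := d + α with hβ
  let g : EuclideanSpace ℝ (Fin d) → ENNReal := fun x => ENNReal.ofReal ((1 + ‖x‖) ^ (-β))
  let h : EuclideanSpace ℝ (Fin d) → ENNReal := fun v =>
    ENNReal.ofReal ((1 + ‖v‖) ^ (-(β - (qx + qv))))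
  have hg : Measurable g := by fun_prop
  have hh : Measurable h := by fun_prop
  have hgfin : ∫⁻ x, g x < ⊤ := finite_integral_one_add_norm (by simp [hβ, hα0])
  have hhfin : ∫⁻ v, h v < ⊤ := finite_integral_one_add_norm (by simp [hβ]; linarith)
  have hmeas : Measurable fun p : (EuclideanSpace ℝ (Fin d) × EuclideanSpace ℝ (Fin d)) × ℝ =>
      g (p.1.1 - p.2 • p.1.2) := by fun_prop
  have hmeas2 : Measurable fun z : EuclideanSpace ℝ (Fin d) × EuclideanSpace ℝ (Fin d) =>
      ∫⁻ s in Set.Icc (0 : ℝ) 3, g (z.1 - s • z.2) := hmeas.lintegral_prod_right'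
  have hinner (v : EuclideanSpace ℝ (Fin d)) :
      ∫⁻ x, ∫⁻ s in Set.Icc (0 : ℝ) 3, g (x - s • v) = (∫⁻ x, g x) * 3 := by
    rw [lintegral_lintegral_swap (by fun_prop)]
    simp_rw [lintegral_sub_right_eq_self g]
    simp
  calc _ ≤ ∫⁻ z : EuclideanSpace ℝ (Fin d) × EuclideanSpace ℝ (Fin d),
        ENNReal.ofReal (3 ^ β) *
          (h z.2 * (g z.1 + ∫⁻ s in Set.Icc (0 : ℝ) 3, g (z.1 - s • z.2))) :=
        lintegral_mono fun z =>
          ofReal_norm_rpow_mul_kinN_le (by linarith) hqx hqv (by linarith) z.1 z.2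
    _ = ENNReal.ofReal (3 ^ β) * ∫⁻ v, h v * ((∫⁻ x, g x) + (∫⁻ x, g x) * 3) := by
        rw [lintegral_const_mul' _ _ ENNReal.ofReal_ne_top, Measure.volume_eq_prod,
          lintegral_prod_symm' _ (by fun_prop)]
        congr 1
        refine lintegral_congr fun v => ?_
        have hhtop : h v ≠ ⊤ := ENNReal.ofReal_ne_top
        simp only
        rw [lintegral_const_mul' _ _ hhtop, lintegral_add_left hg, hinner]
    _ = ENNReal.ofReal (3 ^ β) * ((∫⁻ v, h v) * ((∫⁻ x, g x) + (∫⁻ x, g x) * 3)) := by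
        rw [lintegral_mul_const _ hh]
    _ < ⊤ := by
        have h3 : (∫⁻ x, g x) * 3 < ⊤ := ENNReal.mul_lt_top hgfin (by simp)
        exact ENNReal.mul_lt_top ENNReal.ofReal_lt_top
          (ENNReal.mul_lt_top hhfin (ENNReal.add_lt_top.2 ⟨hgfin, h3⟩))
end
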